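/- arXiv:cs/0611029 — 7 statements merged into one kernel-verified Lean document; each statement's English description precedes it below -/
import Mathlib

section
/- Given a finite Kripke structure M and an LTL formula ψ in positive normal form, M has an initialised infinite path π such that π ⊨ ψ if and only if there exists k ∈ ℕ such that the fixpoint evaluation encoding ⟦M,ψ,k⟧ = ⟦M⟧_k ∧ ⟦LoopConstraints⟧_k ∧ ⟦ψ⟧_0 is propositionally satisfiable; in particular, if π ⊨_k ψ for some initialised path π of M then ⟦M,ψ,k⟧ is satisfiable. -/
namespace BMC

/-- LTL formulas (PLTL without past operators) in positive normal form. -/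
inductive LTL (AP : Type) : Type
  | atom  : AP → LTL AP
  | natom : AP → LTL AP
  | conj  : LTL AP → LTL AP → LTL AP
  | disj  : LTL AP → LTL AP → LTL AP
  | next  : LTL AP → LTL AP
  | untl  : LTL AP → LTL AP → LTL AP
  | rels  : LTL AP → LTL AP → LTL AP

variable {AP S : Type}

/-- Standard LTL semantics `π^i ⊨ φ`. -/
def LTL.sat (L : S → Set AP) (π : ℕ → S) : LTL AP → ℕ → Prop
  | .atom p, i => p ∈ L (π i)
  | .natom p, i => p ∉ L (π i)
  | .conj f g, i => LTL.sat L π f i ∧ LTL.sat L π g i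
  | .disj f g, i => LTL.sat L π f i ∨ LTL.sat L π g i
  | .next f, i => LTL.sat L π f (i + 1)
  | .untl f g, i => ∃ j, i ≤ j ∧ LTL.sat L π g j ∧ ∀ n, i ≤ n → n < j → LTL.sat L π f n
  | .rels f g, i => ∀ j, i ≤ j → (LTL.sat L π g j ∨ ∃ n, i ≤ n ∧ n < j ∧ LTL.sat L π f n)

/-- The no-loop bounded semantics `π^i ⊨_nl φ` with bound `k`. -/
def LTL.satNL (L : S → Set AP) (π : ℕ → S) (k : ℕ) : LTL AP → ℕ → Prop
  | .atom p, i => p ∈ L (π i)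
  | .natom p, i => p ∉ L (π i)
  | .conj f g, i => LTL.satNL L π k f i ∧ LTL.satNL L π k g i
  | .disj f g, i => LTL.satNL L π k f i ∨ LTL.satNL L π k g i
  | .next f, i => i < k ∧ LTL.satNL L π k f (i + 1)
  | .untl f g, i => ∃ j, i ≤ j ∧ j ≤ k ∧ LTL.satNL L π k g j ∧
      ∀ n, i ≤ n → n < j → LTL.satNL L π k f n
  | .rels f g, i => ∃ j, i ≤ j ∧ j ≤ k ∧ LTL.satNL L π k f j ∧
      ∀ n, i ≤ n → n ≤ j → LTL.satNL L π k g n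

/-- `π` is a (k,l)-loop. -/
def IsKLoop (π : ℕ → S) (k l : ℕ) : Prop :=
  0 < l ∧ l ≤ k ∧ π (l - 1) = π k ∧ ∀ i, l ≤ i → π (i + (k + 1 - l)) = π i

/-- The bounded semantics `π ⊨_k φ`. -/
def LTL.bsat (L : S → Set AP) (π : ℕ → S) (k : ℕ) (φ : LTL AP) : Prop :=
  (∃ l, IsKLoop π k l ∧ LTL.sat L π φ 0) ∨ LTL.satNL L π k φ 0

/-- A Kripke structure over state space `S` and atomic propositions `AP`. -/
structure Kripke (S AP : Type) where
  T : S → S → Prop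
  I : S → Prop
  L : S → Set AP

/-- The transition relation is total. -/
def Kripke.Total (M : Kripke S AP) : Prop := ∀ s, ∃ s', M.T s s'

/-- An initialised infinite path of `M`. -/
def Kripke.InitPath (M : Kripke S AP) (π : ℕ → S) : Prop :=
  M.I (π 0) ∧ ∀ i, M.T (π i) (π (i + 1))

/-- Model constraints `⟦M⟧_k = I(s_0) ∧ ⋀_{i=1}^k T(s_{i-1}, s_i)`. -/
def ModelC (M : Kripke S AP) (k : ℕ) (s : ℕ → S) : Prop :=
  M.I (s 0) ∧ ∀ i, 1 ≤ i → i ≤ k → M.T (s (i - 1)) (s i)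

/-- Loop constraints `⟦LoopConstraints⟧_k` on the loop selector variables
`lsel`, the `InLoop` variables and `LoopExists`. -/
def LoopC (k : ℕ) (s : ℕ → S) (lsel inL : ℕ → Prop) (LE : Prop) : Prop :=
  ¬ lsel 0 ∧ ¬ inL 0 ∧
  (∀ i, 1 ≤ i → i ≤ k → (lsel i → s (i - 1) = s k)) ∧
  (∀ i, 1 ≤ i → i ≤ k → (inL i ↔ (inL (i - 1) ∨ lsel i))) ∧
  (∀ i, 1 ≤ i → i ≤ k → (inL (i - 1) → ¬ lsel i)) ∧
  (LE ↔ inL k)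

end BMC
namespace BMC

variable {AP S : Type}

/-- Downward recursion from `k`: value at `i ≥ k` is `base`, and for `i < k`
the value at `i` is `step i` applied to the value at `i + 1`. -/
def down (k : ℕ) (base : Prop) (step : ℕ → Prop → Prop) (i : ℕ) : Prop :=
  Nat.rec base (fun d ih => step (k - (d + 1)) ih) (k - i)

/-- `⋁_{j=1}^k (l_j ∧ e j)`. -/
def loopDisj (k : ℕ) (lsel : ℕ → Prop) (e : ℕ → Prop) : Prop :=
  ∃ j, 1 ≤ j ∧ j ≤ k ∧ lsel j ∧ e j

/-- Auxiliary translation `⟨⟨ψ1 U ψ2⟩⟩_i` for until, given the encodings of the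
subformulas: `⟨⟨·⟩⟩_k = ⟦ψ2⟧_k` and `⟨⟨·⟩⟩_i = ⟦ψ2⟧_i ∨ (⟦ψ1⟧_i ∧ ⟨⟨·⟩⟩_{i+1})`. -/
def auxU (k : ℕ) (e1 e2 : ℕ → Prop) : ℕ → Prop :=
  down k (e2 k) (fun i ih => e2 i ∨ (e1 i ∧ ih))

/-- Auxiliary translation `⟨⟨ψ1 R ψ2⟩⟩_i` for release. -/
def auxR (k : ℕ) (e1 e2 : ℕ → Prop) : ℕ → Prop :=
  down k (e2 k) (fun i ih => e2 i ∧ (e1 i ∨ ih))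

/-- The fixpoint evaluation encoding `⟦φ⟧_i` (a Boolean circuit over the state
variables `s` and the loop selector variables `lsel`). -/
def fixEnc (k : ℕ) (L : S → Set AP) (s : ℕ → S) (lsel : ℕ → Prop) :
    LTL AP → ℕ → Prop
  | .atom p => fun i => p ∈ L (s i)
  | .natom p => fun i => p ∉ L (s i)
  | .conj f g => fun i => fixEnc k L s lsel f i ∧ fixEnc k L s lsel g i
  | .disj f g => fun i => fixEnc k L s lsel f i ∨ fixEnc k L s lsel g i
  | .next f => fun i =>
      if i < k then fixEnc k L s lsel f (i + 1)
      else loopDisj k lsel (fixEnc k L s lsel f)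
  | .untl f g => fun i =>
      down k
        (fixEnc k L s lsel g k ∨ (fixEnc k L s lsel f k ∧
          loopDisj k lsel (auxU k (fixEnc k L s lsel f) (fixEnc k L s lsel g))))
        (fun n ih => fixEnc k L s lsel g n ∨ (fixEnc k L s lsel f n ∧ ih)) i
  | .rels f g => fun i =>
      down k
        (fixEnc k L s lsel g k ∧ (fixEnc k L s lsel f k ∨
          loopDisj k lsel (auxR k (fixEnc k L s lsel f) (fixEnc k L s lsel g))))
        (fun n ih => fixEnc k L s lsel g n ∧ (fixEnc k L s lsel f n ∨ ih)) i

/-- Satisfiability of the fixpoint evaluation encoding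
`⟦M,ψ,k⟧ = ⟦M⟧_k ∧ ⟦LoopConstraints⟧_k ∧ ⟦ψ⟧_0`. -/
def FixSat (M : Kripke S AP) (ψ : LTL AP) (k : ℕ) : Prop :=
  ∃ (s : ℕ → S) (lsel inL : ℕ → Prop) (LE : Prop),
    ModelC M k s ∧ LoopC k s lsel inL LE ∧ fixEnc k M.L s lsel ψ 0

end BMC

namespace BMC

theorem down_top (k : ℕ) (base : Prop) (step : ℕ → Prop → Prop) :
    down k base step k = base := by
  simp [down]

theorem down_lt (k : ℕ) (base : Prop) (step : ℕ → Prop → Prop) (i : ℕ) (h : i < k) :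
    down k base step i = step i (down k base step (i + 1)) := by
  obtain ⟨d, rfl⟩ : ∃ d, k = i + 1 + d := ⟨k - (i + 1), by omega⟩
  have h1 : i + 1 + d - i = d + 1 := by omega
  have h2 : i + 1 + d - (i + 1) = d := by omega
  have h3 : i + 1 + d - (d + 1) = i := by omega
  simp only [down, h1, h2, h3]

theorem down_imp (k : ℕ) (base : Prop) (step : ℕ → Prop → Prop) (P : ℕ → Prop)
    (hb : base → P k) (hs : ∀ i, i < k → ∀ q : Prop, (q → P (i + 1)) → step i q → P i)
    (i : ℕ) (hi : i ≤ k) : down k base step i → P i := by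
  induction hi using Nat.decreasingInduction with
  | self => rw [down_top]; exact hb
  | of_succ i hi ih => rw [down_lt k _ _ i hi]; exact hs i hi _ ih

theorem imp_down (k : ℕ) (base : Prop) (step : ℕ → Prop → Prop) (P : ℕ → Prop)
    (hb : P k → base) (hs : ∀ i, i < k → ∀ q : Prop, (P (i + 1) → q) → P i → step i q)
    (i : ℕ) (hi : i ≤ k) : P i → down k base step i := by
  induction hi using Nat.decreasingInduction with
  | self => rw [down_top]; exact hb
  | of_succ i hi ih => rw [down_lt k _ _ i hi]; exact hs i hi _ ih

theorem down_iff (k : ℕ) (base : Prop) (step : ℕ → Prop → Prop) (P : ℕ → Prop)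
    (hb : base ↔ P k) (hs : ∀ i, i < k → (P i ↔ step i (P (i + 1))))
    (i : ℕ) (hi : i ≤ k) : down k base step i ↔ P i := by
  induction hi using Nat.decreasingInduction with
  | self => rw [down_top]; exact hb
  | of_succ i hi ih => rw [down_lt k _ _ i hi, hs i hi, propext ih]

theorem ex_step (A B : ℕ → Prop) (i : ℕ) :
    (∃ j, i ≤ j ∧ B j ∧ ∀ n, i ≤ n → n < j → A n) ↔
      B i ∨ (A i ∧ ∃ j, i + 1 ≤ j ∧ B j ∧ ∀ n, i + 1 ≤ n → n < j → A n) := by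
  constructor
  · rintro ⟨j, hj, hB, hA⟩
    rcases Nat.eq_or_lt_of_le hj with rfl | h
    · exact Or.inl hB
    · exact Or.inr ⟨hA i le_rfl h, j, h, hB, fun n h1 h2 => hA n (by omega) h2⟩
  · rintro (h | ⟨h, j, hj, hB, hA⟩)
    · exact ⟨i, le_rfl, h, fun n h1 h2 => by omega⟩
    · refine ⟨j, by omega, hB, fun n h1 h2 => ?_⟩
      rcases Nat.eq_or_lt_of_le h1 with rfl | h'
      · exact h
      · exact hA n h' h2

theorem all_step (A B : ℕ → Prop) (i : ℕ) :
    (∀ j, i ≤ j → (B j ∨ ∃ n, i ≤ n ∧ n < j ∧ A n)) ↔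
      B i ∧ (A i ∨ ∀ j, i + 1 ≤ j → (B j ∨ ∃ n, i + 1 ≤ n ∧ n < j ∧ A n)) := by
  constructor
  · intro H
    refine ⟨?_, ?_⟩
    · rcases H i le_rfl with h | ⟨n, h1, h2, _⟩
      · exact h
      · omega
    · by_cases hA : A i
      · exact Or.inl hA
      · refine Or.inr fun j hj => ?_
        rcases H j (by omega) with h | ⟨n, h1, h2, h3⟩
        · exact Or.inl h
        · rcases Nat.eq_or_lt_of_le h1 with rfl | h'
          · exact absurd h3 hA
          · exact Or.inr ⟨n, h', h2, h3⟩
  · rintro ⟨hB, H⟩ j hj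
    rcases Nat.eq_or_lt_of_le hj with rfl | h
    · exact Or.inl hB
    · rcases H with hA | H
      · exact Or.inr ⟨i, le_rfl, h, hA⟩
      · rcases H j h with h | ⟨n, h1, h2, h3⟩
        · exact Or.inl h
        · exact Or.inr ⟨n, by omega, h2, h3⟩

theorem auxU_iff (k : ℕ) (A B : ℕ → Prop) (i : ℕ) (hi : i ≤ k) :
    auxU k A B i ↔ ∃ j, i ≤ j ∧ (j ≤ k ∧ B j) ∧ ∀ n, i ≤ n → n < j → A n := by
  apply down_iff k _ _ (fun i => ∃ j, i ≤ j ∧ (j ≤ k ∧ B j) ∧ ∀ n, i ≤ n → n < j → A n) _ _ i hi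
  · constructor
    · intro h; exact ⟨k, le_rfl, ⟨le_rfl, h⟩, fun n h1 h2 => by omega⟩
    · rintro ⟨j, h1, ⟨h2, h⟩, _⟩
      obtain rfl : j = k := by omega
      exact h
  · intro i hi
    rw [ex_step A (fun j => j ≤ k ∧ B j)]
    simp only [hi.le, true_and]

theorem auxR_iff (k : ℕ) (A B : ℕ → Prop) (i : ℕ) (hi : i ≤ k) :
    auxR k A B i ↔ ∀ j, i ≤ j → ((j ≤ k → B j) ∨ ∃ n, i ≤ n ∧ n < j ∧ A n) := by
  apply down_iff k _ _ (fun i => ∀ j, i ≤ j → ((j ≤ k → B j) ∨ ∃ n, i ≤ n ∧ n < j ∧ A n)) _ _ i hi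
  · constructor
    · intro h j hj
      left; intro h2
      obtain rfl : j = k := by omega
      exact h
    · intro H
      rcases H k le_rfl with h | ⟨n, h1, h2, _⟩
      · exact h le_rfl
      · omega
  · intro i hi
    rw [all_step A (fun j => j ≤ k → B j)]
    simp only [hi.le, true_implies]

variable {AP S : Type}

theorem sat_untl_step (L : S → Set AP) (π : ℕ → S) (f g : LTL AP) (i : ℕ) :
    LTL.sat L π (.untl f g) i ↔
      LTL.sat L π g i ∨ (LTL.sat L π f i ∧ LTL.sat L π (.untl f g) (i + 1)) := by
  simp only [LTL.sat]; exact ex_step _ _ i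

theorem sat_rels_step (L : S → Set AP) (π : ℕ → S) (f g : LTL AP) (i : ℕ) :
    LTL.sat L π (.rels f g) i ↔
      LTL.sat L π g i ∧ (LTL.sat L π f i ∨ LTL.sat L π (.rels f g) (i + 1)) := by
  simp only [LTL.sat]; exact all_step _ _ i

theorem sat_period (L : S → Set AP) (π : ℕ → S) (l p : ℕ)
    (hp : ∀ i, l ≤ i → π (i + p) = π i) (φ : LTL AP) :
    ∀ i, l ≤ i → (LTL.sat L π φ (i + p) ↔ LTL.sat L π φ i) := by
  induction φ with
  | atom a => intro i hi; simp only [LTL.sat, hp i hi]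
  | natom a => intro i hi; simp only [LTL.sat, hp i hi]
  | conj f g hf hg => intro i hi; simp only [LTL.sat, hf i hi, hg i hi]
  | disj f g hf hg => intro i hi; simp only [LTL.sat, hf i hi, hg i hi]
  | next f hf =>
    intro i hi
    simp only [LTL.sat]
    rw [← hf (i + 1) (by omega), Nat.add_right_comm]
  | untl f g hf hg =>
    intro i hi
    simp only [LTL.sat]
    constructor
    · rintro ⟨j, hj, hB, hA⟩
      obtain ⟨j, rfl⟩ : ∃ j', j = j' + p := ⟨j - p, by omega⟩
      exact ⟨j, by omega, (hg j (by omega)).1 hB,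
        fun n h1 h2 => (hf n (by omega)).1 (hA _ (by omega) (by omega))⟩
    · rintro ⟨j, hj, hB, hA⟩
      refine ⟨j + p, by omega, (hg j (by omega)).2 hB, fun n h1 h2 => ?_⟩
      obtain ⟨n, rfl⟩ : ∃ j', n = j' + p := ⟨n - p, by omega⟩
      exact (hf n (by omega)).2 (hA _ (by omega) (by omega))
  | rels f g hf hg =>
    intro i hi
    simp only [LTL.sat]
    constructor
    · intro H j hj
      rcases H (j + p) (by omega) with h | ⟨n, h1, h2, h3⟩
      · exact Or.inl ((hg j (by omega)).1 h)
      · obtain ⟨n, rfl⟩ : ∃ j', n = j' + p := ⟨n - p, by omega⟩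
        exact Or.inr ⟨n, by omega, by omega, (hf n (by omega)).1 h3⟩
    · intro H j hj
      obtain ⟨j, rfl⟩ : ∃ j', j = j' + p := ⟨j - p, by omega⟩
      rcases H j (by omega) with h | ⟨n, h1, h2, h3⟩
      · exact Or.inl ((hg j (by omega)).2 h)
      · exact Or.inr ⟨n + p, by omega, by omega, (hf n (by omega)).2 h3⟩

theorem loopDisj_iff (k l : ℕ) (lsel e : ℕ → Prop) (hl : 1 ≤ l) (hlk : l ≤ k)
    (hsel : ∀ j, 1 ≤ j → j ≤ k → (lsel j ↔ j = l)) : loopDisj k lsel e ↔ e l := by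
  constructor
  · rintro ⟨j, h1, h2, h3, h4⟩
    obtain rfl := (hsel j h1 h2).1 h3
    exact h4
  · intro h
    exact ⟨l, hl, hlk, (hsel l hl hlk).2 rfl, h⟩

/-- With a loop, the encoding is exactly the semantics on the lasso path. -/
theorem enc_loop (L : S → Set AP) (π s : ℕ → S) (k l : ℕ) (lsel : ℕ → Prop)
    (hs : ∀ i, i ≤ k → s i = π i) (hl : 1 ≤ l) (hlk : l ≤ k)
    (hper : ∀ i, l ≤ i → π (i + (k + 1 - l)) = π i)
    (hsel : ∀ j, 1 ≤ j → j ≤ k → (lsel j ↔ j = l)) (φ : LTL AP) :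
    ∀ i, i ≤ k → (fixEnc k L s lsel φ i ↔ LTL.sat L π φ i) := by
  have hP := fun φ => sat_period L π l (k + 1 - l) hper φ
  have hk : l + (k + 1 - l) = k + 1 := by omega
  have hK : ∀ φ, LTL.sat L π φ (k + 1) ↔ LTL.sat L π φ l := fun φ => by
    have := hP φ l le_rfl
    rwa [hk] at this
  induction φ with
  | atom a => intro i hi; simp only [fixEnc, LTL.sat, hs i hi]
  | natom a => intro i hi; simp only [fixEnc, LTL.sat, hs i hi]
  | conj f g hf hg => intro i hi; simp only [fixEnc, LTL.sat, hf i hi, hg i hi]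
  | disj f g hf hg => intro i hi; simp only [fixEnc, LTL.sat, hf i hi, hg i hi]
  | next f hf =>
    intro i hi
    simp only [fixEnc, LTL.sat]
    split_ifs with h
    · exact hf (i + 1) h
    · obtain rfl : i = k := by omega
      rw [loopDisj_iff i l lsel _ hl hlk hsel, hK f, hf l hlk]
  | untl f g hf hg =>
    intro i hi
    simp only [fixEnc]
    apply down_iff k _ _ (LTL.sat L π (.untl f g)) _ _ i hi
    · rw [loopDisj_iff k l lsel _ hl hlk hsel, sat_untl_step, hK (.untl f g), hf k le_rfl,
        hg k le_rfl, auxU_iff k _ _ l hlk]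
      suffices h : (∃ j, l ≤ j ∧ (j ≤ k ∧ fixEnc k L s lsel g j) ∧
          ∀ n, l ≤ n → n < j → fixEnc k L s lsel f n) ↔ LTL.sat L π (.untl f g) l by rw [h]
      simp only [LTL.sat]
      constructor
      · rintro ⟨j, h1, ⟨h2, h3⟩, h4⟩
        exact ⟨j, h1, (hg j h2).1 h3, fun n a b => (hf n (by omega)).1 (h4 n a b)⟩
      · rintro ⟨j, h1, h2, h3⟩
        induction j using Nat.strong_induction_on with
        | _ j ih =>
          by_cases hj : j ≤ k
          · exact ⟨j, h1, ⟨hj, (hg j hj).2 h2⟩, fun n a b => (hf n (by omega)).2 (h3 n a b)⟩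
          · obtain ⟨j, rfl⟩ : ∃ j', j = j' + (k + 1 - l) := ⟨j - (k + 1 - l), by omega⟩
            exact ih j (by omega) (by omega) ((hP g j (by omega)).1 h2)
              fun n a b => h3 n a (by omega)
    · intro i hi
      rw [sat_untl_step, hf i hi.le, hg i hi.le]
  | rels f g hf hg =>
    intro i hi
    simp only [fixEnc]
    apply down_iff k _ _ (LTL.sat L π (.rels f g)) _ _ i hi
    · rw [loopDisj_iff k l lsel _ hl hlk hsel, sat_rels_step, hK (.rels f g), hf k le_rfl,
        hg k le_rfl, auxR_iff k _ _ l hlk]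
      suffices h : (∀ j, l ≤ j → ((j ≤ k → fixEnc k L s lsel g j) ∨
          ∃ n, l ≤ n ∧ n < j ∧ fixEnc k L s lsel f n)) ↔ LTL.sat L π (.rels f g) l by rw [h]
      simp only [LTL.sat]
      constructor
      · intro H j
        induction j using Nat.strong_induction_on with
        | _ j ih =>
          intro hj
          by_cases hjk : j ≤ k
          · rcases H j hj with h | ⟨n, h1, h2, h3⟩
            · exact Or.inl ((hg j hjk).1 (h hjk))
            · exact Or.inr ⟨n, h1, h2, (hf n (by omega)).1 h3⟩
          · obtain ⟨j, rfl⟩ : ∃ j', j = j' + (k + 1 - l) := ⟨j - (k + 1 - l), by omega⟩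
            rcases ih j (by omega) (by omega) with h | ⟨n, h1, h2, h3⟩
            · exact Or.inl ((hP g j (by omega)).2 h)
            · exact Or.inr ⟨n, h1, by omega, h3⟩
      · intro H j hj
        by_cases hjk : j ≤ k
        · rcases H j hj with h | ⟨n, h1, h2, h3⟩
          · exact Or.inl fun _ => (hg j hjk).2 h
          · exact Or.inr ⟨n, h1, h2, (hf n (by omega)).2 h3⟩
        · exact Or.inl fun h => absurd h hjk
    · intro i hi
      rw [sat_rels_step, hf i hi.le, hg i hi.le]

/-- Without a loop, the encoding implies the semantics on every extension. -/
theorem enc_noloop (L : S → Set AP) (π s : ℕ → S) (k : ℕ) (lsel : ℕ → Prop)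
    (hs : ∀ i, i ≤ k → s i = π i)
    (hsel : ∀ j, 1 ≤ j → j ≤ k → ¬ lsel j) (φ : LTL AP) :
    ∀ i, i ≤ k → fixEnc k L s lsel φ i → LTL.sat L π φ i := by
  have hD : ∀ e, ¬ loopDisj k lsel e := by
    rintro e ⟨j, h1, h2, h3, _⟩
    exact hsel j h1 h2 h3
  induction φ with
  | atom a => intro i hi; simp only [fixEnc, LTL.sat, hs i hi]; exact id
  | natom a => intro i hi; simp only [fixEnc, LTL.sat, hs i hi]; exact id
  | conj f g hf hg => intro i hi; simp only [fixEnc, LTL.sat]; exact And.imp (hf i hi) (hg i hi)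
  | disj f g hf hg => intro i hi; simp only [fixEnc, LTL.sat]; exact Or.imp (hf i hi) (hg i hi)
  | next f hf =>
    intro i hi
    simp only [fixEnc, LTL.sat]
    split_ifs with h
    · exact hf (i + 1) h
    · exact fun h => absurd h (hD _)
  | untl f g hf hg =>
    intro i hi
    simp only [fixEnc]
    apply down_imp k _ _ (LTL.sat L π (.untl f g)) _ _ i hi
    · rintro (h | ⟨_, h⟩)
      · rw [sat_untl_step]; exact Or.inl (hg k le_rfl h)
      · exact absurd h (hD _)
    · intro i hi q hq h
      rw [sat_untl_step]
      exact h.imp (hg i hi.le) (And.imp (hf i hi.le) hq)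
  | rels f g hf hg =>
    intro i hi
    simp only [fixEnc]
    apply down_imp k _ _ (LTL.sat L π (.rels f g)) _ _ i hi
    · rintro ⟨h, h' | h'⟩
      · rw [sat_rels_step]; exact ⟨hg k le_rfl h, Or.inl (hf k le_rfl h')⟩
      · exact absurd h' (hD _)
    · intro i hi q hq h
      rw [sat_rels_step]
      exact h.imp (hg i hi.le) (Or.imp (hf i hi.le) hq)

theorem nl_enc (L : S → Set AP) (π : ℕ → S) (k : ℕ) (lsel : ℕ → Prop) (φ : LTL AP) :
    ∀ i, i ≤ k → LTL.satNL L π k φ i → fixEnc k L π lsel φ i := by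
  induction φ with
  | atom a => intro i hi; simp only [fixEnc, LTL.satNL]; exact id
  | natom a => intro i hi; simp only [fixEnc, LTL.satNL]; exact id
  | conj f g hf hg => intro i hi; simp only [fixEnc, LTL.satNL]; exact And.imp (hf i hi) (hg i hi)
  | disj f g hf hg => intro i hi; simp only [fixEnc, LTL.satNL]; exact Or.imp (hf i hi) (hg i hi)
  | next f hf =>
    intro i hi
    simp only [fixEnc, LTL.satNL]
    rintro ⟨h, h'⟩
    rw [if_pos h]
    exact hf _ h h'
  | untl f g hf hg =>
    intro i hi
    simp only [fixEnc]
    apply imp_down k _ _ (LTL.satNL L π k (.untl f g)) _ _ i hi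
    · simp only [LTL.satNL]
      rintro ⟨j, h1, h2, h3, _⟩
      obtain rfl : j = k := by omega
      exact Or.inl (hg j le_rfl h3)
    · intro i hi q hq
      simp only [LTL.satNL] at hq ⊢
      rintro ⟨j, h1, h2, h3, h4⟩
      rcases Nat.eq_or_lt_of_le h1 with rfl | h
      · exact Or.inl (hg _ hi.le h3)
      · exact Or.inr ⟨hf i hi.le (h4 i le_rfl h),
          hq ⟨j, h, h2, h3, fun n a b => h4 n (by omega) b⟩⟩
  | rels f g hf hg =>
    intro i hi
    simp only [fixEnc]
    apply imp_down k _ _ (LTL.satNL L π k (.rels f g)) _ _ i hi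
    · simp only [LTL.satNL]
      rintro ⟨j, h1, h2, h3, h4⟩
      obtain rfl : j = k := by omega
      exact ⟨hg j le_rfl (h4 j le_rfl le_rfl), Or.inl (hf j le_rfl h3)⟩
    · intro i hi q hq
      simp only [LTL.satNL] at hq ⊢
      rintro ⟨j, h1, h2, h3, h4⟩
      refine ⟨hg i hi.le (h4 i le_rfl h1), ?_⟩
      rcases Nat.eq_or_lt_of_le h1 with rfl | h
      · exact Or.inl (hf _ hi.le h3)
      · exact Or.inr (hq ⟨j, h, h2, h3, fun n a b => h4 n (by omega) b⟩)

theorem bsat_fixSat (M : Kripke S AP) (ψ : LTL AP) (k : ℕ) (π : ℕ → S)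
    (hπ : M.InitPath π) (h : LTL.bsat M.L π k ψ) : FixSat M ψ k := by
  have hM : ModelC M k π := ⟨hπ.1, fun i h1 _ => by
    have := hπ.2 (i - 1)
    rwa [Nat.sub_add_cancel h1] at this⟩
  rcases h with ⟨l, ⟨hl, hlk, hq, hper⟩, h⟩ | h
  · refine ⟨π, fun i => i = l, fun i => l ≤ i, l ≤ k, hM, ⟨by omega, by omega, ?_, ?_, ?_, Iff.rfl⟩,
      ?_⟩
    · rintro i _ _ rfl; exact hq
    · intro i h1 h2
      show l ≤ i ↔ (l ≤ i - 1 ∨ i = l)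
      omega
    · intro i h1 h2 h3 h4
      have h3' : l ≤ i - 1 := h3
      have h4' : i = l := h4
      omega
    · exact (enc_loop M.L π π k l _ (fun _ _ => rfl) hl hlk hper (fun _ _ _ => Iff.rfl) ψ 0
        (Nat.zero_le _)).2 h
  · exact ⟨π, fun _ => False, fun _ => False, False, hM, by simp [LoopC],
      nl_enc M.L π k _ ψ 0 (Nat.zero_le _) h⟩

/-- Index map of the lasso with loop positions `a, …, b-1`. -/
def lasso (a b : ℕ) : ℕ → ℕ
  | 0 => 0
  | i + 1 => if lasso a b i + 1 = b then a else lasso a b i + 1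

theorem lasso_lt (a b : ℕ) (hab : a < b) (i : ℕ) : lasso a b i < b := by
  induction i with
  | zero => simp only [lasso]; omega
  | succ i ih => simp only [lasso]; split_ifs <;> omega

theorem lasso_id (a b : ℕ) (i : ℕ) (hi : i < b) : lasso a b i = i := by
  induction i with
  | zero => rfl
  | succ i ih =>
    simp only [lasso]
    rw [ih (by omega), if_neg (by omega)]

theorem lasso_end (a b : ℕ) (hab : a < b) : lasso a b b = a := by
  obtain ⟨c, rfl⟩ : ∃ c, b = c + 1 := ⟨b - 1, by omega⟩
  simp only [lasso]
  rw [lasso_id a (c + 1) c (by omega), if_pos rfl]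

theorem lasso_period (a b : ℕ) (hab : a < b) (i : ℕ) (hi : a ≤ i) :
    lasso a b (i + (b - a)) = lasso a b i := by
  induction i, hi using Nat.le_induction with
  | base =>
    rw [show a + (b - a) = b by omega, lasso_end a b hab, lasso_id a b a hab]
  | succ i hi ih =>
    rw [Nat.add_right_comm]
    simp only [lasso, ih]

theorem lasso_reach (a b : ℕ) (hab : a < b) (d : ℕ) :
    ∀ i, b - lasso a b i = d → ∃ j, i ≤ j ∧ lasso a b j = a := by
  induction d with
  | zero => intro i hi; have := lasso_lt a b hab i; omega
  | succ d ih =>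
    intro i hi
    by_cases h : lasso a b i + 1 = b
    · exact ⟨i + 1, by omega, by simp only [lasso]; rw [if_pos h]⟩
    · have h' : lasso a b (i + 1) = lasso a b i + 1 := by simp only [lasso]; rw [if_neg h]
      obtain ⟨j, hj, hj'⟩ := ih (i + 1) (by omega)
      exact ⟨j, by omega, hj'⟩

theorem lasso_from (a b : ℕ) (j : ℕ) (h : lasso a b j = a) (n : ℕ) (hn : a + n < b) :
    lasso a b (j + n) = a + n := by
  induction n with
  | zero => exact h
  | succ n ih =>
    have := ih (by omega)
    rw [← Nat.add_assoc]
    simp only [lasso]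
    rw [this, if_neg (by omega)]
    omega

/-- Subformulas. -/
def sub : LTL AP → List (LTL AP)
  | .atom p => [.atom p]
  | .natom p => [.natom p]
  | .conj f g => .conj f g :: (sub f ++ sub g)
  | .disj f g => .disj f g :: (sub f ++ sub g)
  | .next f => .next f :: sub f
  | .untl f g => .untl f g :: (sub f ++ sub g)
  | .rels f g => .rels f g :: (sub f ++ sub g)

theorem self_mem_sub (φ : LTL AP) : φ ∈ sub φ := by
  cases φ <;> simp [sub]

theorem lasso_sat (L : S → Set AP) (π : ℕ → S) (a b : ℕ) (hab : a < b) (φ : LTL AP)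
    (H1 : ∀ χ ∈ sub φ, (LTL.sat L π χ b ↔ LTL.sat L π χ a))
    (H2 : ∀ χ ∈ sub φ, ∀ f g, χ = .untl f g → LTL.sat L π χ a →
      ∃ j, a ≤ j ∧ j < b ∧ LTL.sat L π g j) :
    ∀ i, LTL.sat L π φ (lasso a b i) → LTL.sat L (fun n => π (lasso a b n)) φ i := by
  have step : ∀ χ, (LTL.sat L π χ b ↔ LTL.sat L π χ a) → ∀ i,
      LTL.sat L π χ (lasso a b i + 1) → LTL.sat L π χ (lasso a b (i + 1)) := by
    intro χ hχ i h
    simp only [lasso]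
    split_ifs with hc
    · rw [hc] at h; exact hχ.1 h
    · exact h
  induction φ with
  | atom p => intro i; exact id
  | natom p => intro i; exact id
  | conj f g hf hg =>
    intro i
    simp only [sub, List.mem_cons, List.mem_append] at H1 H2
    simp only [LTL.sat]
    exact And.imp (hf (fun χ h => H1 χ (by tauto)) (fun χ h => H2 χ (by tauto)) i)
      (hg (fun χ h => H1 χ (by tauto)) (fun χ h => H2 χ (by tauto)) i)
  | disj f g hf hg =>
    intro i
    simp only [sub, List.mem_cons, List.mem_append] at H1 H2
    simp only [LTL.sat]
    exact Or.imp (hf (fun χ h => H1 χ (by tauto)) (fun χ h => H2 χ (by tauto)) i)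
      (hg (fun χ h => H1 χ (by tauto)) (fun χ h => H2 χ (by tauto)) i)
  | next f hf =>
    intro i
    simp only [sub, List.mem_cons] at H1 H2
    simp only [LTL.sat]
    intro h
    exact hf (fun χ h => H1 χ (by tauto)) (fun χ h => H2 χ (by tauto)) (i + 1)
      (step f (H1 f (Or.inr (self_mem_sub f))) i h)
  | untl f g hf hg =>
    intro i
    simp only [sub, List.mem_cons, List.mem_append] at H1 H2
    have hf := hf (fun χ h => H1 χ (by tauto)) (fun χ h => H2 χ (by tauto))
    have hg := hg (fun χ h => H1 χ (by tauto)) (fun χ h => H2 χ (by tauto))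
    have st := step (.untl f g) (H1 _ (Or.inl rfl))
    intro h
    by_contra hn
    have key : ∀ n, i ≤ n → LTL.sat L π (.untl f g) (lasso a b n) ∧
        ¬ LTL.sat L (fun n => π (lasso a b n)) (.untl f g) n := by
      intro n hn'
      induction n, hn' using Nat.le_induction with
      | base => exact ⟨h, hn⟩
      | succ n _ ih =>
        obtain ⟨h1, h2⟩ := ih
        rw [sat_untl_step] at h1 h2
        push Not at h2
        rcases h1 with h1 | ⟨h1, h3⟩
        · exact absurd (hg n h1) h2.1
        · exact ⟨st n h3, h2.2 (hf n h1)⟩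
    obtain ⟨j, hj, hja⟩ := lasso_reach a b hab _ i rfl
    have ha := (key j hj).1
    rw [hja] at ha
    obtain ⟨m, h1, h2, h3⟩ := H2 _ (Or.inl rfl) f g rfl ha
    have hm := lasso_from a b j hja (m - a) (by omega)
    rw [show a + (m - a) = m by omega] at hm
    rw [← hm] at h3
    exact (key (j + (m - a)) (by omega)).2 ((sat_untl_step _ _ _ _ _).2 (Or.inl (hg _ h3)))
  | rels f g hf hg =>
    intro i
    simp only [sub, List.mem_cons, List.mem_append] at H1 H2
    have hf := hf (fun χ h => H1 χ (by tauto)) (fun χ h => H2 χ (by tauto))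
    have hg := hg (fun χ h => H1 χ (by tauto)) (fun χ h => H2 χ (by tauto))
    have st := step (.rels f g) (H1 _ (Or.inl rfl))
    intro h
    show ∀ j, i ≤ j → (LTL.sat L (fun n => π (lasso a b n)) g j ∨
      ∃ n, i ≤ n ∧ n < j ∧ LTL.sat L (fun n => π (lasso a b n)) f n)
    have key : ∀ n, i ≤ n → LTL.sat L π (.rels f g) (lasso a b n) ∨
        ∃ m, i ≤ m ∧ m < n ∧ LTL.sat L (fun n => π (lasso a b n)) f m := by
      intro n hn'
      induction n, hn' using Nat.le_induction with
      | base => exact Or.inl h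
      | succ n hin ih =>
        rcases ih with h1 | ⟨m, h1, h2, h3⟩
        · rw [sat_rels_step] at h1
          rcases h1.2 with h2 | h2
          · exact Or.inr ⟨n, hin, by omega, hf n h2⟩
          · exact Or.inl (st n h2)
        · exact Or.inr ⟨m, h1, by omega, h3⟩
    intro j hj
    refine (key j hj).imp_left fun h => hg j ?_
    rw [sat_rels_step] at h
    exact h.1

theorem exists_lasso [Finite S] (L : S → Set AP) (π : ℕ → S) (ψ : LTL AP) :
    ∃ a b, a < b ∧ π b = π a ∧
      (∀ χ ∈ sub ψ, (LTL.sat L π χ b ↔ LTL.sat L π χ a)) ∧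
      (∀ χ ∈ sub ψ, ∀ f g, χ = .untl f g → LTL.sat L π χ a →
        ∃ j, a ≤ j ∧ j < b ∧ LTL.sat L π g j) := by
  have hfin : Finite {χ // χ ∈ sub ψ} := (List.finite_toSet (sub ψ)).to_subtype
  let c : ℕ → S × ({χ // χ ∈ sub ψ} → Prop) := fun i => (π i, fun χ => LTL.sat L π χ.1 i)
  obtain ⟨t, ht⟩ := Finite.exists_infinite_fiber c
  have ht' : (c ⁻¹' {t}).Infinite := Set.infinite_coe_iff.1 ht
  obtain ⟨a, ha⟩ := ht'.nonempty
  have hN : ∃ N, ∀ χ : {χ // χ ∈ sub ψ}, ∀ f g, χ.1 = .untl f g → LTL.sat L π χ.1 a →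
        ∃ j, a ≤ j ∧ j < N ∧ LTL.sat L π g j := by
    have : ∀ χ : {χ // χ ∈ sub ψ}, ∃ N, ∀ f g, χ.1 = .untl f g → LTL.sat L π χ.1 a →
        ∃ j, a ≤ j ∧ j < N ∧ LTL.sat L π g j := by
      rintro ⟨χ, hχ⟩
      by_cases hc : ∃ f g, χ = .untl f g ∧ LTL.sat L π χ a
      · obtain ⟨f, g, rfl, h⟩ := hc
        have h' := h
        simp only [LTL.sat] at h'
        obtain ⟨j, h1, h2, _⟩ := h'
        refine ⟨j + 1, fun f' g' he _ => ?_⟩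
        simp only [LTL.untl.injEq] at he
        obtain ⟨rfl, rfl⟩ := he
        exact ⟨j, h1, by omega, h2⟩
      · exact ⟨0, fun f g he h => absurd ⟨f, g, he, h⟩ hc⟩
    choose F hF using this
    obtain ⟨N, hN⟩ := (Set.finite_range F).bddAbove
    refine ⟨N, fun χ f g he h => ?_⟩
    obtain ⟨j, h1, h2, h3⟩ := hF χ f g he h
    exact ⟨j, h1, lt_of_lt_of_le h2 (hN ⟨χ, rfl⟩), h3⟩
  obtain ⟨N, hN⟩ := hN
  obtain ⟨b, hb, hbN⟩ := ht'.exists_gt (max a N)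
  have hab : c b = c a := (show c b = t from hb).trans (show c a = t from ha).symm
  refine ⟨a, b, lt_of_le_of_lt (le_max_left _ _) hbN, congrArg Prod.fst hab, ?_, ?_⟩
  · intro χ hχ
    exact iff_of_eq (congrFun (congrArg Prod.snd hab) ⟨χ, hχ⟩)
  · intro χ hχ f g he h
    obtain ⟨j, h1, h2, h3⟩ := hN ⟨χ, hχ⟩ f g he h
    exact ⟨j, h1, by have := le_max_right a N; omega, h3⟩

theorem fixSat_path (M : Kripke S AP) (hTot : M.Total) (ψ : LTL AP) (k : ℕ)
    (h : FixSat M ψ k) : ∃ π : ℕ → S, M.InitPath π ∧ LTL.sat M.L π ψ 0 := by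
  obtain ⟨s, lsel, inL, LE, ⟨hI, hT⟩, ⟨-, h0, hsel, hin, hex, -⟩, henc⟩ := h
  by_cases hl : ∃ l, 1 ≤ l ∧ l ≤ k ∧ lsel l
  · obtain ⟨l, hl, hlk, hll⟩ := hl
    have uniq' : ∀ i j, 1 ≤ i → i < j → j ≤ k → lsel i → ¬ lsel j := by
      intro i j h1 h2 h3 h4
      have key : ∀ n, i ≤ n → n ≤ k → inL n := by
        intro n hn
        induction n, hn using Nat.le_induction with
        | base => intro h; exact (hin i h1 h).2 (Or.inr h4)
        | succ n hn ih => intro h; exact (hin (n + 1) (by omega) h).2 (Or.inl (ih (by omega)))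
      exact hex j (by omega) h3 (key (j - 1) (by omega) (by omega))
    have uniq : ∀ j, 1 ≤ j → j ≤ k → (lsel j ↔ j = l) := by
      intro j h1 h2
      constructor
      · intro h
        rcases lt_trichotomy j l with h' | h' | h'
        · exact absurd hll (uniq' j l h1 h' hlk h)
        · exact h'
        · exact absurd h (uniq' l j hl h' h2 hll)
      · rintro rfl; exact hll
    refine ⟨fun n => s (lasso l (k + 1) n), ⟨hI, fun i => ?_⟩, ?_⟩
    · have hlt := lasso_lt l (k + 1) (by omega) i
      simp only [lasso]
      split_ifs with hc
      · rw [show lasso l (k + 1) i = k by omega, ← hsel l hl hlk hll]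
        exact hT l hl hlk
      · exact hT (lasso l (k + 1) i + 1) (by omega) (by omega)
    · refine (enc_loop M.L _ s k l lsel (fun i hi => ?_) hl hlk (fun i hi => ?_) uniq ψ 0
        (Nat.zero_le _)).1 henc
      · show s i = s (lasso l (k + 1) i)
        rw [lasso_id l (k + 1) i (by omega)]
      · show s _ = s _
        rw [lasso_period l (k + 1) (by omega) i hi]
  · choose nx hnx using hTot
    let π : ℕ → S := fun i => if i ≤ k then s i else nx^[i - k] (s k)
    refine ⟨π, ⟨?_, fun i => ?_⟩, ?_⟩
    · simpa [π] using hI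
    · by_cases h1 : i + 1 ≤ k
      · have := hT (i + 1) (by omega) h1
        simpa [π, h1, (by omega : i ≤ k)] using this
      · have e1 : π (i + 1) = nx^[(i - k) + 1] (s k) := by
          simp only [π]
          rw [if_neg h1, show i + 1 - k = i - k + 1 by omega]
        have e2 : π i = nx^[i - k] (s k) := by
          simp only [π]
          split_ifs with h2
          · obtain rfl : i = k := by omega
            simp
          · rfl
        rw [e1, e2, Function.iterate_succ_apply']
        exact hnx _
    · refine enc_noloop M.L π s k lsel (fun i hi => ?_) (fun j h1 h2 h3 => hl ⟨j, h1, h2, h3⟩) ψ 0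
        (Nat.zero_le _) henc
      simp only [π]
      rw [if_pos hi]

theorem path_fixSat [Finite S] (M : Kripke S AP) (ψ : LTL AP) (π : ℕ → S)
    (hπ : M.InitPath π) (h : LTL.sat M.L π ψ 0) : ∃ k, FixSat M ψ k := by
  obtain ⟨a, b, hab, hs, H1, H2⟩ := exists_lasso M.L π ψ
  refine ⟨b, bsat_fixSat M ψ b (fun n => π (lasso a b n)) ⟨hπ.1, fun i => ?_⟩
    (Or.inl ⟨a + 1, ⟨by omega, by omega, ?_, fun i hi => ?_⟩, ?_⟩)⟩
  · simp only [lasso]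
    split_ifs with hc
    · have := hπ.2 (lasso a b i)
      rwa [hc, hs] at this
    · exact hπ.2 _
  · show π (lasso a b a) = π (lasso a b b)
    rw [lasso_id a b a hab, lasso_end a b hab]
  · show π _ = π _
    rw [show b + 1 - (a + 1) = b - a by omega, lasso_period a b hab i (by omega)]
  · exact lasso_sat M.L π a b hab ψ H1 H2 0 h

end BMC

open BMC in
/-- Theorem (fixpoint evaluation encoding): `M` has an initialised path
satisfying `ψ` iff the fixpoint evaluation encoding is satisfiable for some
bound `k`; in particular `π ⊨_k ψ` for an initialised path `π` implies the
encoding at `k` is satisfiable. -/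
theorem fixpoint_encoding_correct {S AP : Type} [Finite S]
    (M : Kripke S AP) (hTot : M.Total) (ψ : LTL AP) :
    ((∃ π : ℕ → S, M.InitPath π ∧ LTL.sat M.L π ψ 0) ↔ ∃ k : ℕ, FixSat M ψ k) ∧
    (∀ (k : ℕ) (π : ℕ → S), M.InitPath π → LTL.bsat M.L π k ψ → FixSat M ψ k) := by
  exact ⟨⟨fun ⟨π, hπ, h⟩ => path_fixSat M ψ π hπ h, fun ⟨k, h⟩ => fixSat_path M hTot ψ k h⟩,
    fun k π hπ h => bsat_fixSat M ψ k π hπ h⟩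
end

section
/- Given a finite Kripke structure M and an LTL formula ψ in positive normal form, M has an initialised infinite path π such that π ⊨ ψ if and only if there exists k ∈ ℕ such that the eventuality encoding ⟦M,ψ,k⟧ = ⟦M⟧_k ∧ ⟦LoopConstraints⟧_k ∧ ⟦LastStateFormula⟧_k ∧ ⟦EventuallyLTL⟧_k ∧ ⟦ψ⟧_0 is propositionally satisfiable; in particular, if π ⊨_k ψ for some initialised path π of M then ⟦M,ψ,k⟧ is satisfiable. -/
namespace BMC

variable {AP S : Type}

/-- `⟦LastStateFormula⟧_k` constraints for the formula variable family `vφ` of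
one subformula: if no loop exists the proxy variable at `k+1` is false, and if
`l_i` holds it equals the variable at `i`. -/
def lastStateC (k : ℕ) (lsel : ℕ → Prop) (LE : Prop) (vφ : ℕ → Prop) : Prop :=
  (¬ LE → ¬ vφ (k + 1)) ∧
  ∀ i, 1 ≤ i → i ≤ k → lsel i → (vφ (k + 1) ↔ vφ i)

/-- The constraints of the eventuality encoding, generated for a formula and
(recursively) all of its subformulas.  `v` gives the (fresh, unconstrained)
formula variables `⟦φ⟧_i`, `aux` the auxiliary variables `⟨⟨Fψ2⟩⟩_i`
(for until subformulas) resp. `⟨⟨Gψ2⟩⟩_i` (for release subformulas). -/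
def evC (k : ℕ) (L : S → Set AP) (s : ℕ → S) (lsel inL : ℕ → Prop) (LE : Prop)
    (v aux : LTL AP → ℕ → Prop) : LTL AP → Prop
  | .atom p =>
      (∀ i, i ≤ k → (v (.atom p) i ↔ p ∈ L (s i))) ∧
      lastStateC k lsel LE (v (.atom p))
  | .natom p =>
      (∀ i, i ≤ k → (v (.natom p) i ↔ p ∉ L (s i))) ∧
      lastStateC k lsel LE (v (.natom p))
  | .conj f g =>
      evC k L s lsel inL LE v aux f ∧ evC k L s lsel inL LE v aux g ∧
      (∀ i, i ≤ k + 1 → (v (.conj f g) i ↔ (v f i ∧ v g i))) ∧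
      lastStateC k lsel LE (v (.conj f g))
  | .disj f g =>
      evC k L s lsel inL LE v aux f ∧ evC k L s lsel inL LE v aux g ∧
      (∀ i, i ≤ k + 1 → (v (.disj f g) i ↔ (v f i ∨ v g i))) ∧
      lastStateC k lsel LE (v (.disj f g))
  | .next f =>
      evC k L s lsel inL LE v aux f ∧
      (∀ i, i ≤ k → (v (.next f) i ↔ v f (i + 1))) ∧
      lastStateC k lsel LE (v (.next f))
  | .untl f g =>
      evC k L s lsel inL LE v aux f ∧ evC k L s lsel inL LE v aux g ∧
      (∀ i, i ≤ k → (v (.untl f g) i ↔ (v g i ∨ (v f i ∧ v (.untl f g) (i + 1))))) ∧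
      lastStateC k lsel LE (v (.untl f g)) ∧
      (¬ aux (.untl f g) 0) ∧
      (∀ i, 1 ≤ i → i ≤ k →
        (aux (.untl f g) i ↔ (aux (.untl f g) (i - 1) ∨ (inL i ∧ v g i)))) ∧
      (LE → v (.untl f g) k → aux (.untl f g) k)
  | .rels f g =>
      evC k L s lsel inL LE v aux f ∧ evC k L s lsel inL LE v aux g ∧
      (∀ i, i ≤ k → (v (.rels f g) i ↔ (v g i ∧ (v f i ∨ v (.rels f g) (i + 1))))) ∧
      lastStateC k lsel LE (v (.rels f g)) ∧
      (aux (.rels f g) 0) ∧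
      (∀ i, 1 ≤ i → i ≤ k →
        (aux (.rels f g) i ↔ (aux (.rels f g) (i - 1) ∧ (¬ inL i ∨ v g i)))) ∧
      (LE → aux (.rels f g) k → v (.rels f g) k)

/-- Satisfiability of the eventuality encoding
`⟦M,ψ,k⟧ = ⟦M⟧_k ∧ ⟦LoopConstraints⟧_k ∧ ⟦LastStateFormula⟧_k ∧
⟦EventuallyLTL⟧_k ∧ ⟦ψ⟧_0`. -/
def EvSat (M : Kripke S AP) (ψ : LTL AP) (k : ℕ) : Prop :=
  ∃ (s : ℕ → S) (lsel inL : ℕ → Prop) (LE : Prop)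
    (v aux : LTL AP → ℕ → Prop),
    ModelC M k s ∧ LoopC k s lsel inL LE ∧
    evC k M.L s lsel inL LE v aux ψ ∧ v ψ 0

end BMC

namespace BMC

section helpers

variable {AP S : Type}

lemma sat_untl_unfold (L : S → Set AP) (π : ℕ → S) (f g : LTL AP) (i : ℕ) :
    LTL.sat L π (.untl f g) i ↔
      (LTL.sat L π g i ∨ (LTL.sat L π f i ∧ LTL.sat L π (.untl f g) (i + 1))) := by
  simp only [LTL.sat]
  constructor
  · rintro ⟨j, hij, hg, hf⟩
    rcases Nat.eq_or_lt_of_le hij with h | h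
    · subst h; exact Or.inl hg
    · exact Or.inr ⟨hf i le_rfl h, j, h, hg, fun n h1 h2 => hf n (by omega) h2⟩
  · rintro (hg | ⟨hf, j, hij, hg, hff⟩)
    · exact ⟨i, le_rfl, hg, fun n h1 h2 => by omega⟩
    · refine ⟨j, by omega, hg, fun n h1 h2 => ?_⟩
      rcases Nat.eq_or_lt_of_le h1 with h | h
      · subst h; exact hf
      · exact hff n h h2

lemma sat_rels_unfold (L : S → Set AP) (π : ℕ → S) (f g : LTL AP) (i : ℕ) :
    LTL.sat L π (.rels f g) i ↔
      (LTL.sat L π g i ∧ (LTL.sat L π f i ∨ LTL.sat L π (.rels f g) (i + 1))) := by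
  simp only [LTL.sat]
  constructor
  · intro h
    have hg : LTL.sat L π g i := by
      rcases h i le_rfl with h | ⟨n, h1, h2, _⟩
      · exact h
      · omega
    refine ⟨hg, ?_⟩
    by_cases hf : LTL.sat L π f i
    · exact Or.inl hf
    · right
      intro j hj
      rcases h j (by omega) with h | ⟨n, h1, h2, h3⟩
      · exact Or.inl h
      · right
        rcases Nat.eq_or_lt_of_le h1 with h | h
        · subst h; exact absurd h3 hf
        · exact ⟨n, h, h2, h3⟩
  · rintro ⟨hg, h⟩ j hj
    rcases Nat.eq_or_lt_of_le hj with h' | h'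
    · subst h'; exact Or.inl hg
    · rcases h with hf | h
      · exact Or.inr ⟨i, le_rfl, h', hf⟩
      · rcases h j h' with h | ⟨n, h1, h2, h3⟩
        · exact Or.inl h
        · exact Or.inr ⟨n, by omega, h2, h3⟩

lemma seq_until {F G U : ℕ → Prop} (h : ∀ i, U i ↔ (G i ∨ (F i ∧ U (i + 1))))
    (fair : ∀ i, (∀ j, i ≤ j → U j) → ∃ j, i ≤ j ∧ G j) (i : ℕ) :
    U i ↔ ∃ j, i ≤ j ∧ G j ∧ ∀ n, i ≤ n → n < j → F n := by
  constructor
  · intro hU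
    by_contra hc
    have key : ∀ d, U (i + d) ∧ ∀ n, i ≤ n → n < i + d → F n := by
      intro d
      induction d with
      | zero => exact ⟨hU, fun n h1 h2 => by omega⟩
      | succ d ih =>
        obtain ⟨h1, h2⟩ := ih
        rcases (h _).1 h1 with h3 | ⟨h3, h4⟩
        · exact absurd ⟨i + d, by omega, h3, h2⟩ hc
        · refine ⟨h4, fun n hn hn' => ?_⟩
          by_cases e : n = i + d
          · subst e; exact h3
          · exact h2 n hn (by omega)
    obtain ⟨j, hj, hg⟩ := fair i (fun j hj => by
      have := (key (j - i)).1
      rwa [Nat.add_sub_cancel' hj] at this)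
    have := (key (j - i)).2
    rw [Nat.add_sub_cancel' hj] at this
    exact hc ⟨j, hj, hg, this⟩
  · rintro ⟨j, hj, hg, hf⟩
    obtain ⟨d, rfl⟩ := Nat.exists_eq_add_of_le hj
    clear hj
    induction d generalizing i with
    | zero => exact (h i).2 (Or.inl hg)
    | succ d ih =>
      refine (h i).2 (Or.inr ⟨hf i le_rfl (by omega), ih (i + 1) ?_ ?_⟩)
      · rwa [show i + 1 + d = i + (d + 1) by omega]
      · intro n h1 h2; exact hf n (by omega) (by omega)

lemma seq_rel {F G R : ℕ → Prop} (h : ∀ i, R i ↔ (G i ∧ (F i ∨ R (i + 1))))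
    (fair : ∀ i, (∀ j, i ≤ j → ¬ R j) → ∃ j, i ≤ j ∧ ¬ G j) (i : ℕ) :
    R i ↔ ∀ j, i ≤ j → (G j ∨ ∃ n, i ≤ n ∧ n < j ∧ F n) := by
  have := seq_until (F := fun i => ¬ F i) (G := fun i => ¬ G i) (U := fun i => ¬ R i)
    (fun i => by have := h i; tauto) fair i
  rw [← not_iff_not, this]
  push Not
  rfl

/-- What is needed of positions `a < k` for the lasso encoding. -/
def Good (L : S → Set AP) (π : ℕ → S) (a k : ℕ) : LTL AP → Prop
  | .atom _ => True
  | .natom _ => True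
  | .conj f g => Good L π a k f ∧ Good L π a k g
  | .disj f g => Good L π a k f ∧ Good L π a k g
  | .next f => Good L π a k f ∧ (LTL.sat L π (.next f) a ↔ LTL.sat L π (.next f) k)
  | .untl f g => Good L π a k f ∧ Good L π a k g ∧
      (LTL.sat L π (.untl f g) a ↔ LTL.sat L π (.untl f g) k) ∧
      (LTL.sat L π (.untl f g) k → ∃ j, a < j ∧ j ≤ k ∧ LTL.sat L π g j)
  | .rels f g => Good L π a k f ∧ Good L π a k g ∧
      (LTL.sat L π (.rels f g) a ↔ LTL.sat L π (.rels f g) k) ∧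
      (¬ LTL.sat L π (.rels f g) k → ∃ j, a < j ∧ j ≤ k ∧ ¬ LTL.sat L π g j)

lemma Good.type {L : S → Set AP} {π : ℕ → S} {a k : ℕ} (hs : π a = π k) :
    ∀ {φ : LTL AP}, Good L π a k φ → (LTL.sat L π φ a ↔ LTL.sat L π φ k) := by
  intro φ
  induction φ with
  | atom p => intro _; simp [LTL.sat, hs]
  | natom p => intro _; simp [LTL.sat, hs]
  | conj f g hf hg => rintro ⟨h1, h2⟩; simp [LTL.sat, hf h1, hg h2]
  | disj f g hf hg => rintro ⟨h1, h2⟩; simp [LTL.sat, hf h1, hg h2]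
  | next f hf => exact fun h => h.2
  | untl f g hf hg => exact fun h => h.2.2.1
  | rels f g hf hg => exact fun h => h.2.2.1

/-- valuation for the lasso -/
def lv (L : S → Set AP) (π : ℕ → S) (a k : ℕ) (φ : LTL AP) (i : ℕ) : Prop :=
  LTL.sat L π φ (if i = k + 1 then a + 1 else i)

def laux (L : S → Set AP) (π : ℕ → S) (a : ℕ) : LTL AP → ℕ → Prop
  | .untl _ g, i => ∃ j, a < j ∧ j ≤ i ∧ LTL.sat L π g j
  | .rels _ g, i => ∀ j, a < j → j ≤ i → LTL.sat L π g j
  | _, _ => True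

lemma lv_le {L : S → Set AP} {π : ℕ → S} {a k : ℕ} (φ : LTL AP) {i : ℕ} (h : i ≤ k) :
    lv L π a k φ i ↔ LTL.sat L π φ i := by
  simp [lv, show i ≠ k + 1 by omega]

lemma lv_succ {L : S → Set AP} {π : ℕ → S} {a k : ℕ} (φ : LTL AP) :
    lv L π a k φ (k + 1) ↔ LTL.sat L π φ (a + 1) := by
  simp [lv]

lemma lv_last {L : S → Set AP} {π : ℕ → S} {a k : ℕ} (φ : LTL AP) (_hak : a < k) :
    lastStateC k (fun i => i = a + 1) True (lv L π a k φ) := by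
  refine ⟨fun h => absurd trivial h, ?_⟩
  rintro i h1 h2 rfl
  rw [lv_succ, lv_le φ h2]

lemma Good.evC {L : S → Set AP} {π : ℕ → S} {a k : ℕ} (hs : π a = π k) (hak : a < k) :
    ∀ {φ : LTL AP}, Good L π a k φ →
      evC k L π (fun i => i = a + 1) (fun i => a < i) True (lv L π a k) (laux L π a) φ := by
  intro φ
  induction φ with
  | atom p =>
    intro _
    exact ⟨fun i hi => by rw [lv_le _ hi]; rfl, lv_last _ hak⟩
  | natom p =>
    intro _
    exact ⟨fun i hi => by rw [lv_le _ hi]; rfl, lv_last _ hak⟩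
  | conj f g hf hg =>
    intro h
    exact ⟨hf h.1, hg h.2, fun i hi => Iff.rfl, lv_last _ hak⟩
  | disj f g hf hg =>
    intro h
    exact ⟨hf h.1, hg h.2, fun i hi => Iff.rfl, lv_last _ hak⟩
  | next f hf =>
    intro h
    refine ⟨hf h.1, fun i hi => ?_, lv_last _ hak⟩
    rw [lv_le _ hi]
    by_cases e : i = k
    · subst e
      rw [lv_succ, ← h.2]; rfl
    · rw [lv_le _ (by omega)]; rfl
  | untl f g hf hg =>
    intro h
    refine ⟨hf h.1, hg h.2.1, fun i hi => ?_, lv_last _ hak, ?_, ?_, ?_⟩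
    · rw [lv_le _ hi, lv_le _ hi, lv_le _ hi]
      by_cases e : i = k
      · subst e
        rw [lv_succ, ← h.2.2.1, ← h.1.type hs, ← h.2.1.type hs]
        exact sat_untl_unfold L π f g a
      · rw [lv_le _ (by omega)]
        exact sat_untl_unfold L π f g i
    · rintro ⟨j, h1, h2, _⟩; omega
    · intro i h1 h2
      rw [lv_le _ h2]
      simp only [laux]
      constructor
      · rintro ⟨j, h3, h4, h5⟩
        by_cases e : j = i
        · subst e; exact Or.inr ⟨h3, h5⟩
        · exact Or.inl ⟨j, h3, by omega, h5⟩
      · rintro (⟨j, h3, h4, h5⟩ | ⟨h3, h4⟩)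
        · exact ⟨j, h3, by omega, h5⟩
        · exact ⟨i, h3, le_rfl, h4⟩
    · intro _ hu
      rw [lv_le _ le_rfl] at hu
      exact h.2.2.2 hu
  | rels f g hf hg =>
    intro h
    refine ⟨hf h.1, hg h.2.1, fun i hi => ?_, lv_last _ hak, ?_, ?_, ?_⟩
    · rw [lv_le _ hi, lv_le _ hi, lv_le _ hi]
      by_cases e : i = k
      · subst e
        rw [lv_succ, ← h.2.2.1, ← h.1.type hs, ← h.2.1.type hs]
        exact sat_rels_unfold L π f g a
      · rw [lv_le _ (by omega)]
        exact sat_rels_unfold L π f g i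
    · intro j h1 h2; omega
    · intro i h1 h2
      rw [lv_le _ h2]
      simp only [laux]
      constructor
      · intro h3
        refine ⟨fun j h4 h5 => h3 j h4 (by omega), ?_⟩
        by_cases e : a < i
        · exact Or.inr (h3 i e le_rfl)
        · exact Or.inl e
      · rintro ⟨h3, h4⟩ j h5 h6
        by_cases e : j = i
        · subst e; exact h4.resolve_left (fun h => h h5)
        · exact h3 j h5 (by omega)
    · intro _ ha
      rw [lv_le _ le_rfl]
      by_contra hc
      obtain ⟨j, h1, h2, h3⟩ := h.2.2.2 hc
      exact h3 (ha j h1 h2)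

lemma Good.evSat {M : Kripke S AP} {π : ℕ → S} (hπ : M.InitPath π) {a k : ℕ}
    (hs : π a = π k) (hak : a < k) {ψ : LTL AP} (hg : Good M.L π a k ψ)
    (h : LTL.sat M.L π ψ 0) : EvSat M ψ k := by
  refine ⟨π, fun i => i = a + 1, fun i => a < i, True, lv M.L π a k, laux M.L π a,
    ⟨hπ.1, ?_⟩, ⟨by simp, by simp, ?_, ?_, ?_, by simp [hak]⟩, hg.evC hs hak,
    (lv_le _ (Nat.zero_le _)).2 h⟩
  · intro i h1 h2
    have := hπ.2 (i - 1)
    rwa [Nat.sub_add_cancel h1] at this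
  · rintro i h1 h2 rfl
    simpa using hs
  · intro i h1 h2; omega
  · intro i h1 h2; omega

lemma sat_shift (L : S → Set AP) (π : ℕ → S) (a p : ℕ)
    (hp : ∀ i, a ≤ i → π (i + p) = π i) (φ : LTL AP) :
    ∀ i, a ≤ i → (LTL.sat L π φ (i + p) ↔ LTL.sat L π φ i) := by
  induction φ with
  | atom q => intro i hi; simp [LTL.sat, hp i hi]
  | natom q => intro i hi; simp [LTL.sat, hp i hi]
  | conj f g hf hg => intro i hi; simp [LTL.sat, hf i hi, hg i hi]
  | disj f g hf hg => intro i hi; simp [LTL.sat, hf i hi, hg i hi]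
  | next f hf =>
    intro i hi
    have := hf (i + 1) (by omega)
    rw [show i + 1 + p = i + p + 1 by omega] at this
    exact this
  | untl f g hf hg =>
    intro i hi
    simp only [LTL.sat]
    constructor
    · rintro ⟨j, h1, h2, h3⟩
      obtain ⟨d, rfl⟩ : ∃ d, j = d + p := ⟨j - p, by omega⟩
      exact ⟨d, by omega, (hg d (by omega)).1 h2, fun n h4 h5 =>
        (hf n (by omega)).1 (h3 _ (by omega) (by omega))⟩
    · rintro ⟨j, h1, h2, h3⟩
      refine ⟨j + p, by omega, (hg j (by omega)).2 h2, fun n h4 h5 => ?_⟩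
      obtain ⟨d, rfl⟩ : ∃ d, n = d + p := ⟨n - p, by omega⟩
      exact (hf d (by omega)).2 (h3 _ (by omega) (by omega))
  | rels f g hf hg =>
    intro i hi
    simp only [LTL.sat]
    constructor
    · intro h j hj
      rcases h (j + p) (by omega) with h | ⟨n, h1, h2, h3⟩
      · exact Or.inl ((hg j (by omega)).1 h)
      · obtain ⟨d, rfl⟩ : ∃ d, n = d + p := ⟨n - p, by omega⟩
        exact Or.inr ⟨d, by omega, by omega, (hf d (by omega)).1 h3⟩
    · intro h j hj
      obtain ⟨d, rfl⟩ : ∃ d, j = d + p := ⟨j - p, by omega⟩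
      rcases h d (by omega) with h | ⟨n, h1, h2, h3⟩
      · exact Or.inl ((hg d (by omega)).2 h)
      · exact Or.inr ⟨n + p, by omega, by omega, (hf n (by omega)).2 h3⟩

/-- A periodic predicate is moved back into one period. -/
lemma periodic_back {P : ℕ → Prop} {a p : ℕ} (hp0 : 0 < p)
    (hp : ∀ i, a ≤ i → (P (i + p) ↔ P i)) (j : ℕ) (hj : a ≤ j) (h : P j) :
    ∃ i, a < i ∧ i ≤ a + p ∧ P i := by
  induction j using Nat.strong_induction_on with
  | _ j ih =>
    by_cases e : j ≤ a + p
    · by_cases e' : j = a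
      · exact ⟨j + p, by omega, by omega, (hp j hj).2 h⟩
      · exact ⟨j, by omega, e, h⟩
    · refine ih (j - p) (by omega) (by omega) ((hp (j - p) (by omega)).1 ?_)
      rwa [Nat.sub_add_cancel (by omega)]

lemma good_of_periodic (L : S → Set AP) (π : ℕ → S) (a p : ℕ) (hp0 : 0 < p)
    (hp : ∀ i, a ≤ i → π (i + p) = π i) (φ : LTL AP) : Good L π a (a + p) φ := by
  induction φ with
  | atom q => trivial
  | natom q => trivial
  | conj f g hf hg => exact ⟨hf, hg⟩
  | disj f g hf hg => exact ⟨hf, hg⟩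
  | next f hf => exact ⟨hf, (sat_shift L π a p hp _ a le_rfl).symm⟩
  | untl f g hf hg =>
    refine ⟨hf, hg, (sat_shift L π a p hp _ a le_rfl).symm, ?_⟩
    rintro ⟨j, h1, h2, _⟩
    exact periodic_back hp0 (sat_shift L π a p hp g) j (by omega) h2
  | rels f g hf hg =>
    refine ⟨hf, hg, (sat_shift L π a p hp _ a le_rfl).symm, ?_⟩
    intro h
    simp only [LTL.sat] at h
    push Not at h
    obtain ⟨j, h1, h2, _⟩ := h
    exact periodic_back (P := fun j => ¬ LTL.sat L π g j) hp0
      (fun i hi => not_congr (sat_shift L π a p hp g i hi)) j (by omega) h2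

open Filter in
lemma ultra_type (U : Ultrafilter ℕ) (P : ℕ → Prop) :
    ∀ᶠ a in (U : Filter ℕ), ∀ᶠ k in (U : Filter ℕ), (P a ↔ P k) := by
  rcases U.em P with h | h
  · filter_upwards [h] with a ha
    filter_upwards [h] with k hk
    tauto
  · filter_upwards [h] with a ha
    filter_upwards [h] with k hk
    tauto

open Filter in
lemma ultra_good (U : Ultrafilter ℕ) (hU : (U : Filter ℕ) ≤ atTop) (L : S → Set AP)
    (π : ℕ → S) (φ : LTL AP) :
    ∀ᶠ a in (U : Filter ℕ), ∀ᶠ k in (U : Filter ℕ), Good L π a k φ := by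
  induction φ with
  | atom q => simp [Good]
  | natom q => simp [Good]
  | conj f g hf hg =>
    filter_upwards [hf, hg] with a h1 h2
    filter_upwards [h1, h2] with k h3 h4 using ⟨h3, h4⟩
  | disj f g hf hg =>
    filter_upwards [hf, hg] with a h1 h2
    filter_upwards [h1, h2] with k h3 h4 using ⟨h3, h4⟩
  | next f hf =>
    filter_upwards [hf, ultra_type U (LTL.sat L π (.next f))] with a h1 h2
    filter_upwards [h1, h2] with k h3 h4 using ⟨h3, h4⟩
  | untl f g hf hg =>
    filter_upwards [hf, hg, ultra_type U (LTL.sat L π (.untl f g)),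
      ultra_type U (LTL.sat L π g)] with a h1 h2 h3 h4
    by_cases hu : LTL.sat L π (.untl f g) a
    · obtain ⟨j, h5, h6, _⟩ := id hu
      filter_upwards [h1, h2, h3, h4, hU (eventually_gt_atTop j)] with k g1 g2 g3 g4 g5
      refine ⟨g1, g2, g3, fun _ => ?_⟩
      have g5 : j < k := g5
      by_cases e : j = a
      · subst e
        exact ⟨k, g5, le_rfl, g4.1 h6⟩
      · exact ⟨j, by omega, by omega, h6⟩
    · filter_upwards [h1, h2, h3] with k g1 g2 g3
      exact ⟨g1, g2, g3, fun h => absurd (g3.2 h) hu⟩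
  | rels f g hf hg =>
    filter_upwards [hf, hg, ultra_type U (LTL.sat L π (.rels f g)),
      ultra_type U (LTL.sat L π g)] with a h1 h2 h3 h4
    by_cases hu : LTL.sat L π (.rels f g) a
    · filter_upwards [h1, h2, h3] with k g1 g2 g3
      exact ⟨g1, g2, g3, fun h => absurd (g3.1 hu) h⟩
    · have hu' := hu
      simp only [LTL.sat] at hu'
      push Not at hu'
      obtain ⟨j, h5, h6, _⟩ := hu'
      filter_upwards [h1, h2, h3, h4, hU (eventually_gt_atTop j)] with k g1 g2 g3 g4 g5
      refine ⟨g1, g2, g3, fun _ => ?_⟩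
      have g5 : j < k := g5
      by_cases e : j = a
      · subst e
        exact ⟨k, g5, le_rfl, fun h => h6 (g4.2 h)⟩
      · exact ⟨j, by omega, by omega, h6⟩

open Filter in
lemma evSat_of_path [Finite S] {M : Kripke S AP} {π : ℕ → S} (hπ : M.InitPath π)
    {ψ : LTL AP} (h : LTL.sat M.L π ψ 0) : ∃ k, EvSat M ψ k := by
  let U : Ultrafilter ℕ := hyperfilter ℕ
  have hU : (U : Filter ℕ) ≤ atTop := Nat.hyperfilter_le_atTop
  obtain ⟨s, hs⟩ : ∃ s, ∀ᶠ i in (U : Filter ℕ), π i = s := by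
    have : ∀ᶠ i in (U : Filter ℕ), ∃ s, π i = s := Eventually.of_forall fun i => ⟨_, rfl⟩
    exact Ultrafilter.eventually_exists_iff.1 this
  obtain ⟨a, ha, hs1⟩ := ((ultra_good U hU M.L π ψ).and hs).exists
  obtain ⟨k, ⟨hk, hs2⟩, hak⟩ := ((ha.and hs).and (hU (eventually_gt_atTop a))).exists
  exact ⟨k, hk.evSat hπ (hs1.trans hs2.symm) hak h⟩

def nlaux : LTL AP → ℕ → Prop
  | .untl _ _, _ => False
  | _, _ => True

lemma nl_last (k : ℕ) (P : ℕ → Prop) :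
    lastStateC k (fun _ => False) False (fun i => i ≤ k ∧ P i) :=
  ⟨fun _ h => by have := h.1; omega, fun i _ _ h => h.elim⟩

lemma nl_evC (L : S → Set AP) (π : ℕ → S) (k : ℕ) (φ : LTL AP) :
    evC k L π (fun _ => False) (fun _ => False) False
      (fun φ i => i ≤ k ∧ LTL.satNL L π k φ i) nlaux φ := by
  induction φ with
  | atom q => exact ⟨fun i hi => by simp [LTL.satNL, hi], nl_last k _⟩
  | natom q => exact ⟨fun i hi => by simp [LTL.satNL, hi], nl_last k _⟩
  | conj f g hf hg =>
    refine ⟨hf, hg, fun i hi => ?_, nl_last k _⟩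
    simp only [LTL.satNL]; tauto
  | disj f g hf hg =>
    refine ⟨hf, hg, fun i hi => ?_, nl_last k _⟩
    simp only [LTL.satNL]; tauto
  | next f hf =>
    refine ⟨hf, fun i hi => ?_, nl_last k _⟩
    simp only [LTL.satNL, hi, true_and]; rfl
  | untl f g hf hg =>
    refine ⟨hf, hg, fun i hi => ?_, nl_last k _, id, ?_, fun h => h.elim⟩
    · simp only [LTL.satNL, hi, true_and]
      constructor
      · rintro ⟨j, h1, h2, h3, h4⟩
        by_cases e : i = j
        · subst e; exact Or.inl h3
        · exact Or.inr ⟨h4 i le_rfl (by omega), by omega, j, by omega, h2, h3,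
            fun n h5 h6 => h4 n (by omega) h6⟩
      · rintro (h | ⟨h, _, j, h1, h2, h3, h4⟩)
        · exact ⟨i, le_rfl, hi, h, fun n h1 h2 => by omega⟩
        · refine ⟨j, by omega, h2, h3, fun n h5 h6 => ?_⟩
          by_cases e : n = i
          · subst e; exact h
          · exact h4 n (by omega) h6
    · intro i _ _; simp [nlaux]
  | rels f g hf hg =>
    refine ⟨hf, hg, fun i hi => ?_, nl_last k _, trivial, ?_, fun h => h.elim⟩
    · simp only [LTL.satNL, hi, true_and]
      constructor
      · rintro ⟨j, h1, h2, h3, h4⟩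
        refine ⟨h4 i le_rfl h1, ?_⟩
        by_cases e : i = j
        · subst e; exact Or.inl h3
        · exact Or.inr ⟨by omega, j, by omega, h2, h3, fun n h5 h6 => h4 n (by omega) h6⟩
      · rintro ⟨hg, h | ⟨_, j, h1, h2, h3, h4⟩⟩
        · refine ⟨i, le_rfl, hi, h, fun n h1 h2 => ?_⟩
          obtain rfl : n = i := by omega
          exact hg
        · refine ⟨j, by omega, h2, h3, fun n h5 h6 => ?_⟩
          by_cases e : n = i
          · subst e; exact hg
          · exact h4 n (by omega) h6
    · intro i _ _; simp [nlaux]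

lemma evSat_of_bsat {M : Kripke S AP} {π : ℕ → S} (hπ : M.InitPath π) {k : ℕ}
    {ψ : LTL AP} (h : LTL.bsat M.L π k ψ) : EvSat M ψ k := by
  rcases h with ⟨l, ⟨hl, hlk, hs, hper⟩, h⟩ | h
  · have hg : Good M.L π (l - 1) (l - 1 + (k + 1 - l)) ψ := by
      refine good_of_periodic M.L π (l - 1) (k + 1 - l) (by omega) (fun i hi => ?_) ψ
      by_cases e : l ≤ i
      · exact hper i e
      · obtain rfl : i = l - 1 := by omega
        rw [show l - 1 + (k + 1 - l) = k by omega, hs]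
    rw [show l - 1 + (k + 1 - l) = k by omega] at hg
    exact hg.evSat hπ hs (by omega) h
  · refine ⟨π, fun _ => False, fun _ => False, False,
      fun φ i => i ≤ k ∧ LTL.satNL M.L π k φ i, nlaux, ⟨hπ.1, ?_⟩,
      ⟨id, id, by simp, by simp, by simp, by simp⟩, nl_evC _ _ _ _, Nat.zero_le _, h⟩
    intro i h1 h2
    have := hπ.2 (i - 1)
    rwa [Nat.sub_add_cancel h1] at this

/-! Soundness. -/

lemma nl_last_false {k : ℕ} {L : S → Set AP} {s : ℕ → S} {lsel inL : ℕ → Prop} {LE : Prop}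
    {v aux : LTL AP → ℕ → Prop} {φ : LTL AP} (h : evC k L s lsel inL LE v aux φ) :
    lastStateC k lsel LE (v φ) := by
  cases φ with
  | atom q => exact h.2
  | natom q => exact h.2
  | conj f g => exact h.2.2.2
  | disj f g => exact h.2.2.2
  | next f => exact h.2.2
  | untl f g => exact h.2.2.2.1
  | rels f g => exact h.2.2.2.1

lemma nl_sound {k : ℕ} {L : S → Set AP} {s π : ℕ → S} {lsel inL : ℕ → Prop} {LE : Prop}
    {v aux : LTL AP → ℕ → Prop} (hLE : ¬ LE) (hπ : ∀ i, i ≤ k → π i = s i) (φ : LTL AP) :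
    evC k L s lsel inL LE v aux φ → ∀ i, i ≤ k → v φ i → LTL.sat L π φ i := by
  induction φ with
  | atom q =>
    intro h i hi hv
    simpa [LTL.sat, hπ i hi] using (h.1 i hi).1 hv
  | natom q =>
    intro h i hi hv
    simpa [LTL.sat, hπ i hi] using (h.1 i hi).1 hv
  | conj f g hf hg =>
    intro h i hi hv
    have := (h.2.2.1 i (by omega)).1 hv
    exact ⟨hf h.1 i hi this.1, hg h.2.1 i hi this.2⟩
  | disj f g hf hg =>
    intro h i hi hv
    exact ((h.2.2.1 i (by omega)).1 hv).imp (hf h.1 i hi) (hg h.2.1 i hi)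
  | next f hf =>
    intro h i hi hv
    have h1 := (h.2.1 i hi).1 hv
    by_cases e : i = k
    · subst e
      exact absurd h1 ((nl_last_false h.1).1 hLE)
    · exact hf h.1 (i + 1) (by omega) h1
  | untl f g hf hg =>
    intro h i hi
    have hl := (nl_last_false h).1 hLE
    induction hi using Nat.decreasingInduction with
    | self =>
      intro hv
      rw [sat_untl_unfold]
      exact ((h.2.2.1 k le_rfl).1 hv).imp (hg h.2.1 _ le_rfl) (fun h' => absurd h'.2 hl)
    | of_succ i hi ih =>
      intro hv
      rw [sat_untl_unfold]
      exact ((h.2.2.1 i (by omega)).1 hv).imp (hg h.2.1 _ (by omega))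
        (fun h' => ⟨hf h.1 _ (by omega) h'.1, ih h'.2⟩)
  | rels f g hf hg =>
    intro h i hi
    have hl := (nl_last_false h).1 hLE
    induction hi using Nat.decreasingInduction with
    | self =>
      intro hv
      rw [sat_rels_unfold]
      exact ((h.2.2.1 k le_rfl).1 hv).imp (hg h.2.1 _ le_rfl)
        (fun h' => Or.inl (hf h.1 _ le_rfl (h'.resolve_right hl)))
    | of_succ i hi ih =>
      intro hv
      rw [sat_rels_unfold]
      exact ((h.2.2.1 i (by omega)).1 hv).imp (hg h.2.1 _ (by omega))
        (fun h' => h'.imp (hf h.1 _ (by omega)) ih)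

/-- lasso index -/
def rho (k l : ℕ) : ℕ → ℕ
  | 0 => 0
  | i + 1 => if rho k l i = k then l else rho k l i + 1

lemma rho_le {k l : ℕ} (h : l ≤ k) (i : ℕ) : rho k l i ≤ k := by
  induction i with
  | zero => simp [rho]
  | succ i ih => simp only [rho]; split_ifs <;> omega

lemma rho_add {k l : ℕ} (i d : ℕ) (h : rho k l i + d ≤ k) :
    rho k l (i + d) = rho k l i + d := by
  induction d with
  | zero => rfl
  | succ d ih =>
    have := ih (by omega)
    rw [← add_assoc]
    simp only [rho]
    rw [this, if_neg (by omega)]; omega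

lemma rho_hit {k l : ℕ} (h : l ≤ k) (i m : ℕ) (h1 : l ≤ m) (h2 : m ≤ k) :
    ∃ j, i ≤ j ∧ rho k l j = m := by
  have h0 := rho_le h i
  have e1 : rho k l (i + (k - rho k l i)) = k := by
    rw [rho_add _ _ (by omega)]; omega
  have e2 : rho k l (i + (k - rho k l i) + 1) = l := by
    simp only [rho]; rw [if_pos e1]
  refine ⟨i + (k - rho k l i) + 1 + (m - l), by omega, ?_⟩
  rw [rho_add _ _ (by omega)]; omega

lemma loop_sound {k l : ℕ} {L : S → Set AP} {s : ℕ → S} {lsel inL : ℕ → Prop} {LE : Prop}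
    {v aux : LTL AP → ℕ → Prop} (hLE : LE) (hl1 : 1 ≤ l) (hlk : l ≤ k) (hl : lsel l)
    (hin : ∀ i, i ≤ k → inL i → l ≤ i) (φ : LTL AP) :
    evC k L s lsel inL LE v aux φ →
      ∀ i, v φ (rho k l i) ↔ LTL.sat L (fun i => s (rho k l i)) φ i := by
  have step : ∀ φ, evC k L s lsel inL LE v aux φ →
      ∀ i, v φ (rho k l i + 1) ↔ v φ (rho k l (i + 1)) := by
    intro φ h i
    simp only [rho]
    split_ifs with e
    · rw [e]; exact (nl_last_false h).2 l hl1 hlk hl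
    · rfl
  have hk := rho_le hlk
  induction φ with
  | atom q => intro h i; exact h.1 _ (hk i)
  | natom q => intro h i; exact h.1 _ (hk i)
  | conj f g hf hg =>
    intro h i
    rw [h.2.2.1 _ ((hk i).trans (Nat.le_succ k)), hf h.1, hg h.2.1]; rfl
  | disj f g hf hg =>
    intro h i
    rw [h.2.2.1 _ ((hk i).trans (Nat.le_succ k)), hf h.1, hg h.2.1]; rfl
  | next f hf =>
    intro h i
    rw [h.2.1 _ (hk i), step f h.1, hf h.1]; rfl
  | untl f g hf hg =>
    intro h i
    have key := seq_until (F := fun i => v f (rho k l i)) (G := fun i => v g (rho k l i))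
      (U := fun i => v (.untl f g) (rho k l i))
      (fun i => by
        have := h.2.2.1 _ (hk i)
        rwa [step _ h] at this) ?_ i
    · simp only [hf h.1, hg h.2.1] at key
      exact key
    · intro i hi
      obtain ⟨j, hj, e⟩ := rho_hit hlk i k hlk le_rfl
      have hu := hi j hj
      rw [e] at hu
      have ha := h.2.2.2.2.2.2 hLE hu
      have : ∀ m, m ≤ k → aux (.untl f g) m → ∃ n, n ≤ k ∧ inL n ∧ v g n := by
        intro m
        induction m with
        | zero => intro _ h'; exact absurd h' h.2.2.2.2.1
        | succ m ih =>
          intro hm h'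
          rcases (h.2.2.2.2.2.1 (m + 1) (by omega) hm).1 h' with h' | h'
          · exact ih (by omega) h'
          · exact ⟨m + 1, hm, h'⟩
      obtain ⟨n, h1, h2, h3⟩ := this k le_rfl ha
      obtain ⟨j, hj, e⟩ := rho_hit hlk i n (hin n h1 h2) h1
      exact ⟨j, hj, by simpa only [e] using h3⟩
  | rels f g hf hg =>
    intro h i
    have key := seq_rel (F := fun i => v f (rho k l i)) (G := fun i => v g (rho k l i))
      (R := fun i => v (.rels f g) (rho k l i))
      (fun i => by
        have := h.2.2.1 _ (hk i)
        rwa [step _ h] at this) ?_ i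
    · simp only [hf h.1, hg h.2.1] at key
      exact key
    · intro i hi
      obtain ⟨j, hj, e⟩ := rho_hit hlk i k hlk le_rfl
      have hu := hi j hj
      rw [e] at hu
      have ha : ¬ aux (.rels f g) k := fun h' => hu (h.2.2.2.2.2.2 hLE h')
      have : ∀ m, m ≤ k → ¬ aux (.rels f g) m → ∃ n, n ≤ k ∧ inL n ∧ ¬ v g n := by
        intro m
        induction m with
        | zero => intro _ h'; exact absurd h.2.2.2.2.1 h'
        | succ m ih =>
          intro hm h'
          rw [h.2.2.2.2.2.1 (m + 1) (by omega) hm] at h'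
          by_cases h'' : aux (.rels f g) m
          · refine ⟨m + 1, hm, ?_⟩
            simp only [Nat.add_sub_cancel] at h'
            tauto
          · exact ih (by omega) h''
      obtain ⟨n, h1, h2, h3⟩ := this k le_rfl ha
      obtain ⟨j, hj, e⟩ := rho_hit hlk i n (hin n h1 h2) h1
      exact ⟨j, hj, by simpa only [e] using h3⟩

lemma path_of_evSat {M : Kripke S AP} (hTot : M.Total) {ψ : LTL AP} {k : ℕ}
    (h : EvSat M ψ k) : ∃ π : ℕ → S, M.InitPath π ∧ LTL.sat M.L π ψ 0 := by
  obtain ⟨s, lsel, inL, LE, v, aux, ⟨hI, hT⟩, ⟨-, h0, hs, hin, hex, hLE⟩, hev, hv⟩ := h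
  have hT' : ∀ i, i < k → M.T (s i) (s (i + 1)) := fun i hi => hT (i + 1) (by omega) hi
  by_cases hle : LE
  · -- find the loop start
    have find : ∀ m, m ≤ k → inL m →
        ∃ l, 1 ≤ l ∧ l ≤ m ∧ lsel l ∧ ∀ i, i ≤ m → inL i → l ≤ i := by
      intro m
      induction m with
      | zero => intro _ h; exact absurd h h0
      | succ m ih =>
        intro hm hi
        by_cases e : inL m
        · obtain ⟨l, h1, h2, h3, h4⟩ := ih (by omega) e
          refine ⟨l, h1, by omega, h3, fun i hi' hi'' => ?_⟩
          by_cases e' : i = m + 1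
          · omega
          · exact h4 i (by omega) hi''
        · have := ((hin (m + 1) (by omega) hm).1 hi).resolve_left e
          refine ⟨m + 1, by omega, le_rfl, this, fun i hi' hi'' => ?_⟩
          by_contra hlt
          have mono : ∀ d, i + d ≤ m → inL (i + d) := by
            intro d
            induction d with
            | zero => intro _; exact hi''
            | succ d ihd =>
              intro hd
              exact (hin (i + (d + 1)) (by omega) (by omega)).2 (Or.inl (ihd (by omega)))
          have := mono (m - i) (by omega)
          rw [Nat.add_sub_cancel' (by omega)] at this
          exact e this
    obtain ⟨l, h1, h2, h3, h4⟩ := find k le_rfl (hLE.1 hle)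
    refine ⟨fun i => s (rho k l i), ⟨hI, fun i => ?_⟩, ?_⟩
    · simp only [rho]
      have := rho_le h2 i
      split_ifs with e
      · rw [e, ← hs l h1 h2 h3]
        exact hT l h1 h2
      · exact hT' _ (by omega)
    · exact (loop_sound hle h1 h2 h3 h4 ψ hev 0).1 hv
  · choose nx hnx using hTot
    refine ⟨fun i => nx^[i - k] (s (min i k)), ⟨by simpa using hI, fun i => ?_⟩, ?_⟩
    · beta_reduce
      by_cases e : i < k
      · rw [show i - k = 0 by omega, show i + 1 - k = 0 by omega, min_eq_left (by omega),
          min_eq_left (by omega)]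
        exact hT' i e
      · rw [show i + 1 - k = (i - k) + 1 by omega, min_eq_right (by omega),
          min_eq_right (by omega), Function.iterate_succ_apply']
        exact hnx _
    · refine nl_sound hle (fun i hi => ?_) ψ hev 0 (Nat.zero_le _) hv
      simp only [show i - k = 0 by omega, min_eq_left hi]; rfl

end helpers

end BMC

open BMC in
/-- Theorem (eventuality encoding): `M` has an initialised path satisfying `ψ`
iff the eventuality encoding is satisfiable for some bound `k`; in particular
`π ⊨_k ψ` for an initialised path `π` implies the encoding at `k` is
satisfiable. -/
theorem eventuality_encoding_correct {S AP : Type} [Finite S]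
    (M : Kripke S AP) (hTot : M.Total) (ψ : LTL AP) :
    ((∃ π : ℕ → S, M.InitPath π ∧ LTL.sat M.L π ψ 0) ↔ ∃ k : ℕ, EvSat M ψ k) ∧
    (∀ (k : ℕ) (π : ℕ → S), M.InitPath π → LTL.bsat M.L π k ψ → EvSat M ψ k) := by
  exact ⟨⟨fun ⟨_, hπ, h⟩ => evSat_of_path hπ h, fun ⟨_, h⟩ => path_of_evSat hTot h⟩,
    fun _ _ hπ h => evSat_of_bsat hπ h⟩
end

section
/- In the propositional formula LoopExists ⇒ InLoop_k together with the defining constraints of the eventuality and Büchi auxiliary variables, the constraint LoopExists ⇒ (⟦ψ1Uψ2⟧_k ⇒ ⟨⟨Fψ2⟩⟩_k) is satisfiable if and only if LoopExists ⇒ ⟨⟨Acc(ψ1Uψ2)⟩⟩_k is satisfiable (relative to the remaining constraints of the Büchi/eventuality encodings, which are shared), and analogously LoopExists ⇒ (⟨⟨Gψ2⟩⟩_k ⇒ ⟦ψ1Rψ2⟧_k) is satisfiable iff LoopExists ⇒ ⟨⟨Acc(ψ1Rψ2)⟩⟩_k is satisfiable. Consequently the auxiliary eventuality encoding is satisfiable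 iff the auxiliary Büchi encoding is. -/
theorem aux_ex (k : ℕ) (q : ℕ → Prop) (a : ℕ → Prop) (h0 : ¬ a 0)
    (h : ∀ i, 1 ≤ i → i ≤ k → (a i ↔ (a (i - 1) ∨ q i))) :
    ∀ n, n ≤ k → (a n ↔ ∃ i, 1 ≤ i ∧ i ≤ n ∧ q i) := by
  intro n
  induction n with
  | zero =>
    intro _
    refine ⟨fun h => absurd h h0, ?_⟩
    rintro ⟨i, h1, h2, _⟩
    omega
  | succ n ih =>
    intro hn
    rw [h (n + 1) (by omega) hn, Nat.add_sub_cancel, ih (by omega)]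
    constructor
    · rintro (⟨i, h1, h2, h3⟩ | h3)
      · exact ⟨i, h1, by omega, h3⟩
      · exact ⟨n + 1, by omega, le_refl _, h3⟩
    · rintro ⟨i, h1, h2, h3⟩
      rcases Nat.lt_or_ge n i with h4 | h4
      · have : i = n + 1 := by omega
        subst this
        exact Or.inr h3
      · exact Or.inl ⟨i, h1, h4, h3⟩

theorem aux_sat (k : ℕ) (q : ℕ → Prop) (C : Prop → Prop) :
    (∃ a : ℕ → Prop, (¬ a 0) ∧ (∀ i, 1 ≤ i → i ≤ k → (a i ↔ (a (i - 1) ∨ q i))) ∧ C (a k)) ↔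
      C (∃ i, 1 ≤ i ∧ i ≤ k ∧ q i) := by
  constructor
  · rintro ⟨a, h0, h, hc⟩
    rwa [propext (aux_ex k q a h0 h k le_rfl)] at hc
  · intro hc
    refine ⟨fun n => ∃ i, 1 ≤ i ∧ i ≤ n ∧ q i, ?_, ?_, hc⟩
    · rintro ⟨i, h1, h2, _⟩
      omega
    · intro n hn _
      constructor
      · rintro ⟨i, h1, h2, h3⟩
        rcases Nat.lt_or_ge (n - 1) i with h4 | h4
        · have : i = n := by omega
          subst this
          exact Or.inr h3
        · exact Or.inl ⟨i, h1, h4, h3⟩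
      · rintro (⟨i, h1, h2, h3⟩ | h3)
        · exact ⟨i, h1, by omega, h3⟩
        · exact ⟨n, hn, le_rfl, h3⟩

theorem aux_chain (k : ℕ) (lsel inL P : ℕ → Prop) (hIn0 : ¬ inL 0)
    (hIn : ∀ i, 1 ≤ i → i ≤ k → (inL i ↔ (inL (i - 1) ∨ lsel i)))
    (hs : ∀ i, i ≤ k → inL i → P i → P (i + 1))
    (hl : ∀ i, 1 ≤ i → i ≤ k → lsel i → P (k + 1) → P i)
    (hLk : inL k) (hk : P k) : ∀ i, i ≤ k → inL i → P i := by
  intro i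
  induction i with
  | zero => exact fun _ h => absurd h hIn0
  | succ n ih =>
    intro hn h
    rcases (hIn (n + 1) (by omega) hn).1 h with h | h
    · exact hs n (by omega) h (ih (by omega) h)
    · exact hl _ (by omega) hn h (hs k le_rfl hLk hk)

theorem aux_core (k : ℕ) (lsel inL : ℕ → Prop) (LE : Prop) (hIn0 : ¬ inL 0)
    (hIn : ∀ i, 1 ≤ i → i ≤ k → (inL i ↔ (inL (i - 1) ∨ lsel i)))
    (hLE : LE ↔ inL k) (q P : ℕ → Prop)
    (hs : ∀ i, i ≤ k → P i → ¬ q i → P (i + 1))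
    (hl : ∀ i, 1 ≤ i → i ≤ k → lsel i → (P (k + 1) ↔ P i)) :
    (LE → P k → ∃ i, 1 ≤ i ∧ i ≤ k ∧ inL i ∧ q i) ↔
      (LE → ∃ i, 1 ≤ i ∧ i ≤ k ∧ inL i ∧ (q i ∨ ¬ P i)) := by
  constructor
  · intro h hle
    by_cases hp : P k
    · obtain ⟨i, h1, h2, h3, h4⟩ := h hle hp
      exact ⟨i, h1, h2, h3, Or.inl h4⟩
    · have hk := hLE.1 hle
      refine ⟨k, ?_, le_rfl, hk, Or.inr hp⟩
      rcases Nat.eq_zero_or_pos k with h0 | h0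
      · rw [h0] at hk
        exact absurd hk hIn0
      · exact h0
  · intro h hle hp
    by_contra hn
    obtain ⟨i, h1, h2, h3, h4⟩ := h hle
    have hq : ∀ i, i ≤ k → inL i → ¬ q i := by
      intro j hj hi hqj
      rcases Nat.eq_zero_or_pos j with h0 | h0
      · rw [h0] at hi
        exact hIn0 hi
      · exact hn ⟨j, h0, hj, hi, hqj⟩
    rcases h4 with h4 | h4
    · exact hq i h2 h3 h4
    · exact h4 (aux_chain k lsel inL P hIn0 hIn
        (fun i hi hin hpi => hs i hi hpi (hq i hi hin))
        (fun i a b c => (hl i a b c).1) (hLE.1 hle) hp i h2 h3)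

/-- Equivalence of the auxiliary eventuality encoding and the auxiliary Büchi
encoding, relative to the shared constraints of the two encodings.

The shared data consists of the loop selector variables `lsel`, the `InLoop`
variables, `LoopExists`, and the formula variables: `v1, v2, vU` are the
variables `⟦ψ1⟧_i, ⟦ψ2⟧_i, ⟦ψ1 U ψ2⟧_i` of an until subformula and
`w1, w2, vR` the variables `⟦ψ1⟧_i, ⟦ψ2⟧_i, ⟦ψ1 R ψ2⟧_i` of a release
subformula, subject to the one-step identities, the `LastStateFormula`
constraints and the loop constraints listed below.

Conclusion: the existentially quantified auxiliary eventuality variables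
`⟨⟨Fψ2⟩⟩_i` together with the constraint
`LoopExists ⇒ (⟦ψ1Uψ2⟧_k ⇒ ⟨⟨Fψ2⟩⟩_k)` are satisfiable iff the auxiliary
Büchi variables `⟨⟨Acc(ψ1Uψ2)⟩⟩_i` together with the constraint
`LoopExists ⇒ ⟨⟨Acc(ψ1Uψ2)⟩⟩_k` are, and analogously for release; hence the
auxiliary eventuality encoding is satisfiable iff the auxiliary Büchi
encoding is. -/
theorem aux_eventuality_sat_iff_aux_buchi_sat
    (k : ℕ) (lsel inL : ℕ → Prop) (LE : Prop)
    (hIn0 : ¬ inL 0)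
    (hIn : ∀ i, 1 ≤ i → i ≤ k → (inL i ↔ (inL (i - 1) ∨ lsel i)))
    (hLE : LE ↔ inL k)
    -- shared data for an until subformula ψ1 U ψ2
    (v1 v2 vU : ℕ → Prop)
    (hU : ∀ i, i ≤ k → (vU i ↔ (v2 i ∨ (v1 i ∧ vU (i + 1)))))
    (hUnl : ¬ LE → ¬ vU (k + 1))
    (hUl : ∀ i, 1 ≤ i → i ≤ k → lsel i → (vU (k + 1) ↔ vU i))
    -- shared data for a release subformula ψ1 R ψ2
    (w1 w2 vR : ℕ → Prop)
    (hR : ∀ i, i ≤ k → (vR i ↔ (w2 i ∧ (w1 i ∨ vR (i + 1)))))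
    (hRnl : ¬ LE → ¬ vR (k + 1))
    (hRl : ∀ i, 1 ≤ i → i ≤ k → lsel i → (vR (k + 1) ↔ vR i)) :
    -- until: eventuality auxiliary encoding satisfiable iff Büchi one is
    (((∃ aF : ℕ → Prop,
        (¬ aF 0) ∧
        (∀ i, 1 ≤ i → i ≤ k → (aF i ↔ (aF (i - 1) ∨ (inL i ∧ v2 i)))) ∧
        (LE → vU k → aF k)) ↔
      (∃ aA : ℕ → Prop,
        (¬ aA 0) ∧
        (∀ i, 1 ≤ i → i ≤ k →
          (aA i ↔ (aA (i - 1) ∨ (inL i ∧ (v2 i ∨ ¬ vU i))))) ∧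
        (LE → aA k))) ∧
    -- release: dually
    ((∃ aG : ℕ → Prop,
        (aG 0) ∧
        (∀ i, 1 ≤ i → i ≤ k → (aG i ↔ (aG (i - 1) ∧ (¬ inL i ∨ w2 i)))) ∧
        (LE → aG k → vR k)) ↔
      (∃ aA : ℕ → Prop,
        (¬ aA 0) ∧
        (∀ i, 1 ≤ i → i ≤ k →
          (aA i ↔ (aA (i - 1) ∨ (inL i ∧ (¬ w2 i ∨ vR i))))) ∧
        (LE → aA k)))) := by
  constructor
  · rw [aux_sat k (fun i => inL i ∧ v2 i) (fun p => LE → vU k → p),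
      aux_sat k (fun i => inL i ∧ (v2 i ∨ ¬ vU i)) (fun p => LE → p)]
    refine aux_core k lsel inL LE hIn0 hIn hLE v2 vU ?_ hUl
    intro i hi hp hq
    have := hU i hi
    clear hU hR hUl hRl hIn hUnl hRnl hLE
    tauto
  · have hc := aux_core k lsel inL LE hIn0 hIn hLE (fun i => ¬ w2 i) (fun i => ¬ vR i)
      (by
        intro i hi hp hq
        have := hR i hi
        clear hU hR hUl hRl hIn hUnl hRnl hLE
        tauto)
      (fun i a b c => not_congr (hRl i a b c))
    simp only [not_not] at hc
    rw [aux_sat k (fun i => inL i ∧ (¬ w2 i ∨ vR i)) (fun p => LE → p), ← hc,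
      ← aux_sat k (fun i => inL i ∧ ¬ w2 i) (fun p => LE → ¬ vR k → p)]
    constructor
    · rintro ⟨a, h0, h, h'⟩
      refine ⟨fun n => ¬ a n, not_not.2 h0, ?_, ?_⟩
      · intro i h1 h2
        have := h i h1 h2
        clear hc hU hR hUl hRl hIn h h' hUnl hRnl hLE
        tauto
      · exact fun hle hv ha => hv (h' hle ha)
    · rintro ⟨a, h0, h, h'⟩
      refine ⟨fun n => ¬ a n, h0, ?_, ?_⟩
      · intro i h1 h2
        have := h i h1 h2
        clear hc hU hR hUl hRl hIn h h' hUnl hRnl hLE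
        tauto
      · exact fun hle ha => by_contra fun hv => ha (h' hle hv)
end

section
/- Given a finite fair Kripke structure M with acceptance sets F_0,…,F_f, M has an initialised fair (k,l)-loop π for some 0 < l ≤ k if and only if the general Büchi encoding ⟦M,k⟧ = ⟦M⟧_k ∧ ⟦LoopConstraints⟧_k ∧ ⟦BüchiLoopConstraints⟧_k is propositionally satisfiable for that k; in particular M has a fair lasso-shaped initialised path iff there exists k ∈ ℕ such that ⟦M,k⟧ is satisfiable. -/
namespace BMC

variable {AP S : Type}

/-- A fair Kripke structure with acceptance sets `F_0, …, F_f`. -/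
structure FairKripke (S AP : Type) (f : ℕ) extends Kripke S AP where
  F : Fin (f + 1) → Set S

/-- A path is fair iff it visits each acceptance set infinitely often. -/
def FairKripke.FairPath {f : ℕ} (M : FairKripke S AP f) (π : ℕ → S) : Prop :=
  ∀ m : Fin (f + 1), ∀ N : ℕ, ∃ i, N ≤ i ∧ π i ∈ M.F m

end BMC
namespace BMC

variable {AP S : Type}

/-- Büchi loop constraints `⟦BüchiLoopConstraints⟧_k`: `LoopExists ⇔ ⊤`, and
for each acceptance set `F_m` the variables `⟨⟨Acc_m⟩⟩_i` with their defining
recurrence and the requirement `LoopExists ⇒ ⟨⟨Acc_m⟩⟩_k`. -/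
def BuchiLoopC {f : ℕ} (M : FairKripke S AP f) (k : ℕ) (s : ℕ → S)
    (inL : ℕ → Prop) (LE : Prop) (acc : Fin (f + 1) → ℕ → Prop) : Prop :=
  LE ∧
  (∀ m, ¬ acc m 0) ∧
  (∀ m, ∀ i, 1 ≤ i → i ≤ k → (acc m i ↔ (acc m (i - 1) ∨ (inL i ∧ s i ∈ M.F m)))) ∧
  (∀ m, LE → acc m k)

/-- Satisfiability of the general Büchi encoding
`⟦M,k⟧ = ⟦M⟧_k ∧ ⟦LoopConstraints⟧_k ∧ ⟦BüchiLoopConstraints⟧_k`. -/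
def GBSat {f : ℕ} (M : FairKripke S AP f) (k : ℕ) : Prop :=
  ∃ (s : ℕ → S) (lsel inL : ℕ → Prop) (LE : Prop) (acc : Fin (f + 1) → ℕ → Prop),
    ModelC M.toKripke k s ∧ LoopC k s lsel inL LE ∧ BuchiLoopC M k s inL LE acc

end BMC

namespace BMC

theorem gb_fwd {S AP : Type} {f : ℕ} (M : FairKripke S AP f) (k : ℕ)
    (π : ℕ → S) (l : ℕ) (hI : M.toKripke.InitPath π) (hL : IsKLoop π k l)
    (hF : M.FairPath π) : GBSat M k := by
  obtain ⟨hl0, hlk, hb, hper⟩ := hL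
  have down : ∀ i, l ≤ i → ∃ j, l ≤ j ∧ j ≤ k ∧ π j = π i := by
    intro i
    induction i using Nat.strong_induction_on with
    | _ i ih =>
      intro hi
      by_cases hik : i ≤ k
      · exact ⟨i, hi, hik, rfl⟩
      · obtain ⟨j, h1, h2, h3⟩ := ih (i - (k + 1 - l)) (by omega) (by omega)
        refine ⟨j, h1, h2, h3.trans ?_⟩
        have := hper (i - (k + 1 - l)) (by omega)
        rw [← this]
        congr 1
        omega
  refine ⟨π, fun i => i = l, fun i => l ≤ i, True,
    fun m i => ∃ j, l ≤ j ∧ j ≤ i ∧ π j ∈ M.F m, ⟨hI.1, ?_⟩,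
    ⟨?_, ?_, ?_, ?_, ?_, ?_⟩, trivial, ?_, ?_, ?_⟩
  · intro i h1 _
    have := hI.2 (i - 1)
    rwa [Nat.sub_add_cancel h1] at this
  · show ¬ (0 = l)
    omega
  · show ¬ (l ≤ 0)
    omega
  · intro i _ _ h
    have h : i = l := h
    rw [h]; exact hb
  · intro i _ _
    show l ≤ i ↔ (l ≤ i - 1 ∨ i = l)
    omega
  · intro i _ _
    show l ≤ i - 1 → ¬ (i = l)
    omega
  · show True ↔ l ≤ k
    simp [hlk]
  · rintro m ⟨j, h1, h2, _⟩
    omega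
  · intro m i hi _
    constructor
    · rintro ⟨j, h1, h2, h3⟩
      by_cases hj : j = i
      · subst hj
        exact Or.inr ⟨h1, h3⟩
      · exact Or.inl ⟨j, h1, by omega, h3⟩
    · rintro (⟨j, h1, h2, h3⟩ | ⟨h1, h3⟩)
      · exact ⟨j, h1, by omega, h3⟩
      · exact ⟨i, h1, le_rfl, h3⟩
  · intro m _
    obtain ⟨i, hi, him⟩ := hF m l
    obtain ⟨j, h1, h2, h3⟩ := down i hi
    exact ⟨j, h1, h2, h3 ▸ him⟩

theorem gb_bwd {S AP : Type} {f : ℕ} (M : FairKripke S AP f) (k : ℕ)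
    (h : GBSat M k) : ∃ (π : ℕ → S) (l : ℕ), M.toKripke.InitPath π ∧ IsKLoop π k l ∧
        M.FairPath π := by
  classical
  obtain ⟨s, lsel, inL, LE, acc, ⟨hI, hT⟩, ⟨hl0, hi0, hls, hin, -, hLE⟩, hle, ha0, hacc, hak⟩ := h
  have hex : ∀ i, i ≤ k → inL i → ∃ l, l ≤ i ∧ lsel l := by
    intro i
    induction i with
    | zero => intro _ h; exact absurd h hi0
    | succ n ih =>
      intro hk h
      rcases (hin (n + 1) (by omega) hk).1 h with h | h
      · obtain ⟨l, h1, h2⟩ := ih (by omega) h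
        exact ⟨l, by omega, h2⟩
      · exact ⟨n + 1, le_rfl, h⟩
  have hx : ∃ l, lsel l := by
    obtain ⟨l, _, h⟩ := hex k le_rfl (hLE.1 hle)
    exact ⟨l, h⟩
  obtain ⟨l, hl, hmin⟩ : ∃ l, lsel l ∧ ∀ l', lsel l' → l ≤ l' :=
    ⟨Nat.find hx, Nat.find_spec hx, fun l' h => Nat.find_min' hx h⟩
  have hinl : ∀ i, i ≤ k → inL i → l ≤ i := by
    intro i hk h
    obtain ⟨l', h1, h2⟩ := hex i hk h
    exact (hmin l' h2).trans h1
  have hlk : l ≤ k := hinl k le_rfl (hLE.1 hle)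
  have hlpos : 0 < l := by
    rcases Nat.eq_zero_or_pos l with h | h
    · subst h; exact absurd hl hl0
    · exact h
  have hb : s (l - 1) = s k := hls l hlpos hlk hl
  have hac : ∀ m i, i ≤ k → acc m i → ∃ j, l ≤ j ∧ j ≤ i ∧ s j ∈ M.F m := by
    intro m i
    induction i with
    | zero => intro _ h; exact absurd h (ha0 m)
    | succ n ih =>
      intro hk h
      rcases (hacc m (n + 1) (by omega) hk).1 h with h | ⟨h, h'⟩
      · obtain ⟨j, h1, h2, h3⟩ := ih (by omega) h
        exact ⟨j, h1, by omega, h3⟩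
      · exact ⟨n + 1, hinl _ hk h, le_rfl, h'⟩
  obtain ⟨p, hp⟩ : ∃ p, p = k + 1 - l := ⟨_, rfl⟩
  have hp0 : 0 < p := by omega
  obtain ⟨π, hπ⟩ : ∃ π : ℕ → S, π = fun i => if i < l then s i else s (l + (i - l) % p) :=
    ⟨_, rfl⟩
  have hlt : ∀ i, i < l → π i = s i := by
    intro i hi; rw [hπ]; simp [hi]
  have hge : ∀ i, π (l + i) = s (l + i % p) := by
    intro i; rw [hπ]; simp
  have hsm : ∀ i, i ≤ k → π i = s i := by
    intro i hi
    by_cases h : i < l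
    · exact hlt i h
    · obtain ⟨d, rfl⟩ := Nat.exists_eq_add_of_le (not_lt.1 h)
      rw [hge, Nat.mod_eq_of_lt (by omega)]
  refine ⟨π, l, ⟨?_, ?_⟩, ⟨hlpos, hlk, ?_, ?_⟩, ?_⟩
  · rw [hlt 0 hlpos]; exact hI
  · intro i
    by_cases h : i < l
    · rw [hsm i (by omega), hsm (i + 1) (by omega)]
      exact hT (i + 1) (by omega) (by omega)
    · obtain ⟨d, rfl⟩ := Nat.exists_eq_add_of_le (not_lt.1 h)
      rw [add_assoc, hge, hge]
      have hd : d % p < p := Nat.mod_lt _ hp0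
      by_cases hc : d % p + 1 < p
      · have : (d + 1) % p = d % p + 1 := by
          rw [← Nat.mod_add_mod, Nat.mod_eq_of_lt hc]
        rw [this]
        exact hT (l + (d % p + 1)) (by omega) (by omega)
      · have h1 : (d + 1) % p = 0 := by
          rw [← Nat.mod_add_mod, show d % p + 1 = p by omega, Nat.mod_self]
        rw [h1, show l + d % p = k by omega, ← hb]
        exact hT l hlpos hlk
  · rw [hsm _ (by omega), hsm _ le_rfl]; exact hb
  · intro i hi
    obtain ⟨d, rfl⟩ := Nat.exists_eq_add_of_le hi
    rw [← hp, add_assoc, hge, hge, Nat.add_mod_right]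
  · intro m N
    obtain ⟨j, h1, h2, h3⟩ := hac m k le_rfl (hak m hle)
    obtain ⟨d, rfl⟩ := Nat.exists_eq_add_of_le h1
    refine ⟨l + (d + p * N), ?_, ?_⟩
    · have := Nat.le_mul_of_pos_left N hp0
      omega
    · rw [hge, Nat.add_mul_mod_self_left, Nat.mod_eq_of_lt (by omega)]
      exact h3

end BMC

open BMC in
/-- Theorem (general Büchi encoding): `M` has an initialised fair (k,l)-loop
for some `0 < l ≤ k` iff the general Büchi encoding `⟦M,k⟧` is satisfiable for
that `k`; in particular `M` has a fair lasso-shaped initialised path iff there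
is a `k` such that `⟦M,k⟧` is satisfiable. -/
theorem general_buchi_encoding_correct {S AP : Type} {f : ℕ} [Finite S]
    (M : FairKripke S AP f) (hTot : M.toKripke.Total) :
    (∀ k : ℕ,
      (∃ (π : ℕ → S) (l : ℕ), M.toKripke.InitPath π ∧ IsKLoop π k l ∧
        M.FairPath π) ↔ GBSat M k) ∧
    ((∃ π : ℕ → S, M.toKripke.InitPath π ∧ (∃ k l, IsKLoop π k l) ∧
        M.FairPath π) ↔ ∃ k, GBSat M k) := by
  have key : ∀ k : ℕ,
      (∃ (π : ℕ → S) (l : ℕ), M.toKripke.InitPath π ∧ IsKLoop π k l ∧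
        M.FairPath π) ↔ GBSat M k := fun k =>
    ⟨fun ⟨π, l, h1, h2, h3⟩ => gb_fwd M k π l h1 h2 h3, gb_bwd M k⟩
  refine ⟨key, ?_, ?_⟩
  · rintro ⟨π, h1, ⟨k, l, h2⟩, h3⟩
    exact ⟨k, (key k).1 ⟨π, l, h1, h2, h3⟩⟩
  · rintro ⟨k, h⟩
    obtain ⟨π, l, h1, h2, h3⟩ := (key k).2 h
    exact ⟨π, h1, ⟨k, l, h2⟩, h3⟩
end

section
/- Let M = (S,T,I,L,F={F_0,…,F_f}) be a finite fair Kripke structure and let M̂ be its liveness-to-safety transformation. Then M has an initialised fair path if and only if some state ŝ with LoopClosed(ŝ) true is reachable in M̂ from an initial state of M̂. -/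
namespace BMC

variable {AP S : Type}

/-- A state of the liveness-to-safety transformation `M̂`: the original state
variables `v`, their copy `v̄`, the oracle `l_s`, and the flags `InLoop`,
`LoopClosed` and `Acc_m`. -/
structure L2SState (S : Type) (f : ℕ) where
  v : S
  vbar : S
  ls : Prop
  inLoop : Prop
  loopClosed : Prop
  acc : Fin (f + 1) → Prop

/-- State invariants of `M̂` (lines 11–13): `LoopClosed ⇒ InLoop`,
`LoopClosed ⇒ v = v̄`, and `LoopClosed ⇒ Acc_m` for all `m`. -/
def L2SInv {f : ℕ} (M : FairKripke S AP f) (x : L2SState S f) : Prop :=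
  (x.loopClosed → x.inLoop) ∧
  (x.loopClosed → x.v = x.vbar) ∧
  (∀ m, x.loopClosed → x.acc m)

/-- Initial states of `M̂` (lines 3–5, 9): `v` initial in `M`, and `l_s`,
`InLoop` and the `Acc_m` are false. -/
def L2SInit {f : ℕ} (M : FairKripke S AP f) (x : L2SState S f) : Prop :=
  L2SInv M x ∧ M.I x.v ∧ ¬ x.ls ∧ ¬ x.inLoop ∧ ∀ m, ¬ x.acc m

/-- Transitions of `M̂` (lines 2, 6–8, 10). -/
def L2STrans {f : ℕ} (M : FairKripke S AP f) (x y : L2SState S f) : Prop :=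
  L2SInv M x ∧ L2SInv M y ∧
  M.T x.v y.v ∧
  (y.inLoop ↔ (x.inLoop ∨ y.ls)) ∧
  (x.inLoop → ¬ y.ls) ∧
  (y.ls → y.vbar = x.v) ∧ (¬ y.ls → y.vbar = x.vbar) ∧
  (∀ m, y.acc m ↔ (x.acc m ∨ (y.inLoop ∧ y.v ∈ M.F m)))

/-- `x` is reachable in `M̂` from an initial state. -/
def L2SReach {f : ℕ} (M : FairKripke S AP f) (x : L2SState S f) : Prop :=
  ∃ (n : ℕ) (σ : ℕ → L2SState S f),
    L2SInit M (σ 0) ∧ (∀ i, i < n → L2STrans M (σ i) (σ (i + 1))) ∧ σ n = x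

end BMC
namespace BMC

theorem aux_inv {S AP : Type} {f : ℕ} (M : FairKripke S AP f) (n : ℕ) (σ : ℕ → L2SState S f)
    (h0 : L2SInit M (σ 0)) (hT : ∀ i, i < n → L2STrans M (σ i) (σ (i + 1))) :
    ∀ i, i ≤ n → (¬ (σ i).inLoop → ∀ m, ¬ (σ i).acc m) ∧
      ((σ i).inLoop → ∃ a, a < i ∧ (σ i).vbar = (σ a).v ∧
        ∀ m, (σ i).acc m → ∃ k, a < k ∧ k ≤ i ∧ (σ k).v ∈ M.F m) := by
  intro i
  induction i with
  | zero =>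
    intro _
    obtain ⟨_, _, _, h1, h2⟩ := h0
    exact ⟨fun _ => h2, fun h => absurd h h1⟩
  | succ i ih =>
    intro hi
    obtain ⟨ih1, ih2⟩ := ih (by omega)
    obtain ⟨_, _, _, hL, hls, hv1, hv2, hacc⟩ := hT i (by omega)
    refine ⟨?_, ?_⟩
    · intro hn m hm
      have h1 : ¬ (σ i).inLoop := fun h => hn (hL.2 (Or.inl h))
      rcases (hacc m).1 hm with h | h
      · exact ih1 h1 m h
      · exact hn h.1
    · intro hy
      by_cases hx : (σ i).inLoop
      · obtain ⟨a, ha, hva, hk⟩ := ih2 hx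
        refine ⟨a, by omega, (hv2 (hls hx)).trans hva, ?_⟩
        intro m hm
        rcases (hacc m).1 hm with h | h
        · obtain ⟨k, h1, h2, h3⟩ := hk m h
          exact ⟨k, h1, by omega, h3⟩
        · exact ⟨i + 1, by omega, le_refl _, h.2⟩
      · have hl : (σ (i + 1)).ls := (hL.1 hy).resolve_left hx
        refine ⟨i, by omega, hv1 hl, ?_⟩
        intro m hm
        rcases (hacc m).1 hm with h | h
        · exact absurd h (ih1 hx m)
        · exact ⟨i + 1, by omega, le_refl _, h.2⟩

theorem aux_lasso {S AP : Type} {f : ℕ} (M : FairKripke S AP f) (n a : ℕ) (w : ℕ → S)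
    (han : a < n) (h0 : M.I (w 0)) (hT : ∀ i, i < n → M.T (w i) (w (i + 1)))
    (hcl : w n = w a) (hF : ∀ m, ∃ k, a < k ∧ k ≤ n ∧ w k ∈ M.F m) :
    ∃ π : ℕ → S, M.toKripke.InitPath π ∧ M.FairPath π := by
  obtain ⟨p, rfl⟩ : ∃ p, n = a + p := ⟨n - a, by omega⟩
  have hp : 0 < p := by omega
  let g : ℕ → ℕ := fun i => if i < a then i else a + (i - a) % p
  have g1 : ∀ i, i < a → g i = i := fun i h => if_pos h
  have g2 : ∀ q, g (a + q) = a + q % p := by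
    intro q
    simp [g]
  refine ⟨fun i => w (g i), ⟨?_, ?_⟩, ?_⟩
  · have : g 0 = 0 := by
      rcases Nat.eq_zero_or_pos a with h | h
      · have := g2 0
        simpa [h] using this
      · exact g1 0 h
    simpa [this] using h0
  · intro i
    show M.T (w (g i)) (w (g (i + 1)))
    by_cases h : i < a
    · have e : g (i + 1) = i + 1 := by
        by_cases h' : i + 1 < a
        · exact g1 _ h'
        · have : i + 1 = a + 0 := by omega
          rw [this, g2]; simp
      rw [g1 i h, e]
      exact hT i (by omega)
    · obtain ⟨q, rfl⟩ : ∃ q, i = a + q := ⟨i - a, by omega⟩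
      have hq := Nat.mod_lt q hp
      have hd := Nat.mod_add_div q p
      rw [add_assoc, g2, g2]
      by_cases h' : q % p + 1 < p
      · have : (q + 1) % p = q % p + 1 := by
          rw [← Nat.mod_add_mod, Nat.mod_eq_of_lt h']
        rw [this]
        exact hT _ (by omega)
      · have h2 : q % p + 1 = p := by omega
        have : (q + 1) % p = 0 := by
          rw [← Nat.mod_add_mod, h2, Nat.mod_self]
        rw [this, add_zero, ← hcl]
        have := hT (a + q % p) (by omega)
        rwa [add_assoc, h2] at this
  · intro m N
    obtain ⟨k, hk1, hk2, hk3⟩ := hF m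
    obtain ⟨r, hr, hrF⟩ : ∃ r, r < p ∧ w (a + r) ∈ M.F m := by
      by_cases h : k = a + p
      · exact ⟨0, hp, by rw [add_zero, ← hcl, ← h]; exact hk3⟩
      · refine ⟨k - a, by omega, ?_⟩
        rwa [show a + (k - a) = k by omega]
    refine ⟨a + (r + N * p), ?_, ?_⟩
    · have : N ≤ N * p := Nat.le_mul_of_pos_right N hp
      omega
    · show w (g _) ∈ _
      rw [g2, Nat.add_mul_mod_self_right, Nat.mod_eq_of_lt hr]
      exact hrF

theorem aux_fwd {S AP : Type} {f : ℕ} [Finite S] (M : FairKripke S AP f) (π : ℕ → S)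
    (hI : M.toKripke.InitPath π) (hF : M.FairPath π) :
    ∃ x : L2SState S f, L2SReach M x ∧ x.loopClosed := by
  obtain ⟨s, hs⟩ := Finite.exists_infinite_fiber π
  have hs' : (π ⁻¹' {s}).Infinite := Set.infinite_coe_iff.1 hs
  obtain ⟨a, ha, -⟩ := hs'.exists_gt 0
  choose k hk1 hk2 using fun m => hF m (a + 1)
  obtain ⟨B, hB⟩ := (Set.finite_range k).bddAbove
  obtain ⟨n, hn, hnB⟩ := hs'.exists_gt (a + B)
  have ha' : π a = s := ha
  have hn' : π n = s := hn
  let σ : ℕ → L2SState S f := fun i =>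
    { v := π i, vbar := s, ls := i = a + 1, inLoop := a + 1 ≤ i, loopClosed := i = n,
      acc := fun m => ∃ j, a + 1 ≤ j ∧ j ≤ i ∧ π j ∈ M.F m }
  have hinv : ∀ i, L2SInv M (σ i) := by
    intro i
    refine ⟨?_, ?_, ?_⟩
    · intro (h : i = n)
      show a + 1 ≤ i
      omega
    · intro (h : i = n)
      show π i = s
      rw [h, hn']
    · intro m (h : i = n)
      have : k m ≤ B := hB ⟨m, rfl⟩
      exact ⟨k m, hk1 m, by omega, hk2 m⟩
  refine ⟨σ n, ⟨n, σ, ⟨hinv 0, hI.1, ?_, ?_, ?_⟩, ?_, rfl⟩, rfl⟩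
  · intro (h : 0 = a + 1)
    omega
  · intro (h : a + 1 ≤ 0)
    omega
  · rintro m ⟨j, h1, h2, -⟩
    omega
  · intro i _
    refine ⟨hinv _, hinv _, hI.2 i, ?_, ?_, ?_, fun _ => rfl, ?_⟩
    · show a + 1 ≤ i + 1 ↔ (a + 1 ≤ i ∨ i + 1 = a + 1)
      omega
    · show a + 1 ≤ i → ¬ (i + 1 = a + 1)
      omega
    · intro (h : i + 1 = a + 1)
      show s = π i
      rw [← ha', show i = a by omega]
    · intro m
      constructor
      · rintro ⟨j, h1, h2, h3⟩
        by_cases h : j = i + 1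
        · subst h
          exact Or.inr ⟨h1, h3⟩
        · exact Or.inl ⟨j, h1, by omega, h3⟩
      · rintro (⟨j, h1, h2, h3⟩ | ⟨h1, h3⟩)
        · exact ⟨j, h1, by omega, h3⟩
        · exact ⟨i + 1, h1, le_refl _, h3⟩

end BMC

open BMC in
/-- Theorem (liveness to safety): the fair Kripke structure `M` has an
initialised fair path iff some state `ŝ` with `LoopClosed(ŝ)` true is
reachable in the liveness-to-safety transformation `M̂` of `M`. -/
theorem liveness_to_safety_correct {S AP : Type} {f : ℕ} [Finite S]
    (M : FairKripke S AP f) (hTot : M.toKripke.Total) :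
    (∃ π : ℕ → S, M.toKripke.InitPath π ∧ M.FairPath π) ↔
    (∃ x : L2SState S f, L2SReach M x ∧ x.loopClosed) := by
  constructor
  · rintro ⟨π, hI, hF⟩
    exact aux_fwd M π hI hF
  · rintro ⟨x, ⟨n, σ, h0, hT, rfl⟩, hc⟩
    have hinv : L2SInv M (σ n) := by
      cases n with
      | zero => exact h0.1
      | succ n => exact (hT n (by omega)).2.1
    obtain ⟨a, ha, hva, hk⟩ := (aux_inv M n σ h0 hT n (le_refl _)).2 (hinv.1 hc)
    exact aux_lasso M n a (fun i => (σ i).v) ha h0.2.1 (fun i hi => (hT i hi).2.2.1)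
      ((hinv.2.1 hc).trans hva) (fun m => hk m (hinv.2.2 m hc))
end

section
/- Given a finite fair Kripke structure M, M has an initialised fair path if and only if there exists k ∈ ℕ such that the propositional formula ⟦M̂⟧_k ∧ LoopClosed(ŝ_k) is satisfiable, where M̂ is the liveness-to-safety transformation of M and ⟦M̂⟧_k = Î(ŝ_0) ∧ ⋀_{i=1}^k T̂(ŝ_{i-1},ŝ_i) is its k-step unrolling. -/
namespace BMC

/-- The `k`-step unrolling `⟦M̂⟧_k = Î(ŝ_0) ∧ ⋀_{i=1}^k T̂(ŝ_{i-1}, ŝ_i)` of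
the liveness-to-safety transformation `M̂` of `M`. -/
def L2SUnroll {AP S : Type} {f : ℕ} (M : FairKripke S AP f) (k : ℕ)
    (σ : ℕ → L2SState S f) : Prop :=
  L2SInit M (σ 0) ∧ ∀ i, 1 ≤ i → i ≤ k → L2STrans M (σ (i - 1)) (σ i)

end BMC

open BMC in
theorem l2s_forward {S AP : Type} {f : ℕ} [Finite S]
    (M : FairKripke S AP f) (π : ℕ → S) (hI : M.toKripke.InitPath π) (hF : M.FairPath π) :
    ∃ (k : ℕ) (σ : ℕ → L2SState S f), L2SUnroll M k σ ∧ (σ k).loopClosed := by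
  obtain ⟨s, hs⟩ := Finite.exists_infinite_fiber π
  have hs : (π ⁻¹' {s}).Infinite := Set.infinite_coe_iff.mp hs
  obtain ⟨p, hp⟩ := hs.nonempty
  choose g hg1 hg2 using fun m => hF m (p + 1)
  obtain ⟨k, hk, hkb⟩ := hs.exists_gt (p + ∑ m, g m)
  have hp' : π p = s := hp
  have hk' : π k = s := hk
  have hgk : ∀ m, g m ≤ k := fun m => by
    have := Finset.single_le_sum (f := g) (fun i _ => Nat.zero_le _) (Finset.mem_univ m)
    omega
  have hinv : ∀ i, L2SInv M (⟨π i, π p, i = p + 1, p + 1 ≤ i, i = k,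
      fun m => ∃ j, p + 1 ≤ j ∧ j ≤ i ∧ π j ∈ M.F m⟩ : L2SState S f) := by
    intro i
    refine ⟨?_, ?_, ?_⟩
    · intro h
      dsimp only at h ⊢
      omega
    · intro h
      dsimp only at h ⊢
      rw [h, hk', hp']
    · intro m h
      dsimp only at h ⊢
      exact ⟨g m, hg1 m, h ▸ hgk m, hg2 m⟩
  refine ⟨k, fun i => ⟨π i, π p, i = p + 1, p + 1 ≤ i, i = k,
    fun m => ∃ j, p + 1 ≤ j ∧ j ≤ i ∧ π j ∈ M.F m⟩, ⟨⟨hinv 0, hI.1, ?_, ?_, ?_⟩, ?_⟩, rfl⟩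
  · dsimp only
    omega
  · dsimp only
    omega
  · rintro m ⟨j, h1, h2, -⟩
    omega
  · intro i hi hik
    obtain ⟨i, rfl⟩ : ∃ i', i = i' + 1 := ⟨i - 1, by omega⟩
    refine ⟨hinv _, hinv _, hI.2 i, ?_, ?_, ?_, ?_, ?_⟩
    · dsimp only
      omega
    · dsimp only
      omega
    · intro h
      dsimp only at h ⊢
      have : i = p := by omega
      simp [this]
    · intro h
      rfl
    · intro m
      dsimp only [Nat.add_sub_cancel]
      constructor
      · rintro ⟨j, h1, h2, h3⟩
        rcases Nat.lt_or_ge i j with h | h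
        · obtain rfl : j = i + 1 := by omega
          exact Or.inr ⟨h1, h3⟩
        · exact Or.inl ⟨j, h1, h, h3⟩
      · rintro (⟨j, h1, h2, h3⟩ | ⟨h1, h3⟩)
        · exact ⟨j, h1, by omega, h3⟩
        · exact ⟨i + 1, h1, le_rfl, h3⟩

open BMC in
theorem l2s_backward {S AP : Type} {f : ℕ}
    (M : FairKripke S AP f) (k : ℕ) (σ : ℕ → L2SState S f)
    (hU : L2SUnroll M k σ) (hc : (σ k).loopClosed) :
    ∃ π : ℕ → S, M.toKripke.InitPath π ∧ M.FairPath π := by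
  obtain ⟨⟨hinv0, hI, hls, hil, hacc⟩, hT⟩ := hU
  have hT' : ∀ i, i < k → L2STrans M (σ i) (σ (i + 1)) := fun i hi => by
    simpa using hT (i + 1) (by omega) (by omega)
  have key : ∀ i, i ≤ k → (¬ (σ i).inLoop ∧ ∀ m, ¬ (σ i).acc m) ∨
      ∃ l, l < i ∧ (σ i).inLoop ∧ (σ i).vbar = (σ l).v ∧
        ∀ m, (σ i).acc m → ∃ j, l < j ∧ j ≤ i ∧ (σ j).v ∈ M.F m := by
    intro i
    induction i with
    | zero => exact fun _ => Or.inl ⟨hil, hacc⟩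
    | succ i ih =>
      intro hi
      obtain ⟨-, -, -, h1, h2, h3, h4, h5⟩ := hT' i (by omega)
      rcases ih (by omega) with ⟨a, b⟩ | ⟨l, hl, a, b, c⟩
      · by_cases hy : (σ (i + 1)).ls
        · refine Or.inr ⟨i, by omega, h1.2 (Or.inr hy), h3 hy, fun m hm => ?_⟩
          rcases (h5 m).1 hm with h | h
          · exact absurd h (b m)
          · exact ⟨i + 1, by omega, le_rfl, h.2⟩
        · have hn : ¬ (σ (i + 1)).inLoop := fun h => (h1.1 h).elim a hy
          exact Or.inl ⟨hn, fun m hm => ((h5 m).1 hm).elim (b m) (fun h => hn h.1)⟩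
      · refine Or.inr ⟨l, by omega, h1.2 (Or.inl a), (h4 (h2 a)).trans b, fun m hm => ?_⟩
        rcases (h5 m).1 hm with h | h
        · obtain ⟨j, x, y, z⟩ := c m h
          exact ⟨j, x, by omega, z⟩
        · exact ⟨i + 1, by omega, le_rfl, h.2⟩
  have hinv : L2SInv M (σ k) := by
    rcases Nat.eq_zero_or_pos k with h | h
    · rw [h]; exact hinv0
    · exact (hT k h le_rfl).2.1
  obtain ⟨q1, q2, q3⟩ := hinv
  rcases key k le_rfl with h | ⟨l, hl, -, hv, hA⟩
  · exact absurd (q1 hc) h.1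
  have hkl : (σ k).v = (σ l).v := (q2 hc).trans hv
  obtain ⟨d, rfl⟩ : ∃ d, k = l + d := ⟨k - l, by omega⟩
  have hd : 0 < d := by omega
  refine ⟨fun n => (σ (if n < l then n else l + (n - l) % d)).v, ⟨?_, ?_⟩, ?_⟩
  · by_cases h : 0 < l
    · simpa [h] using hI
    · obtain rfl : l = 0 := by omega
      simpa using hI
  · intro n
    dsimp only
    by_cases h : n + 1 < l
    · rw [if_pos h, if_pos (by omega)]
      exact (hT' n (by omega)).2.2.1
    · rw [if_neg h]
      by_cases h' : n < l
      · obtain rfl : l = n + 1 := by omega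
        rw [if_pos h']
        simpa using (hT' n (by omega)).2.2.1
      · rw [if_neg h']
        obtain ⟨e, rfl⟩ : ∃ e, n = l + e := ⟨n - l, by omega⟩
        have e1 : l + e + 1 - l = e + 1 := by omega
        have e2 : l + e - l = e := by omega
        rw [e1, e2]
        have hlt := Nat.mod_lt e hd
        have ht := (hT' (l + e % d) (by omega)).2.2.1
        by_cases hw : e % d + 1 = d
        · have : (e + 1) % d = 0 := by
            rw [← Nat.mod_add_mod, hw, Nat.mod_self]
          rw [this, Nat.add_zero, ← hkl]
          rwa [add_assoc, hw] at ht
        · have : (e + 1) % d = e % d + 1 := by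
            rw [← Nat.mod_add_mod, Nat.mod_eq_of_lt (by omega)]
          rw [this]
          exact ht
  · intro m N
    obtain ⟨j, j1, j2, j3⟩ := hA m (q3 m hc)
    obtain ⟨e, rfl⟩ : ∃ e, j = l + e := ⟨j - l, by omega⟩
    refine ⟨l + (e + N * d), ?_, ?_⟩
    · nlinarith
    · dsimp only
      rw [if_neg (by omega), Nat.add_sub_cancel_left, Nat.add_mul_mod_self_right]
      by_cases he : e = d
      · subst he
        rw [Nat.mod_self, Nat.add_zero, ← hkl]
        exact j3
      · rw [Nat.mod_eq_of_lt (by omega)]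
        exact j3

open BMC in
/-- Theorem (BMC via liveness to safety): `M` has an initialised fair path iff
there exists `k` such that `⟦M̂⟧_k ∧ LoopClosed(ŝ_k)` is satisfiable. -/
theorem liveness_to_safety_bmc_correct {S AP : Type} {f : ℕ} [Finite S]
    (M : FairKripke S AP f) (hTot : M.toKripke.Total) :
    (∃ π : ℕ → S, M.toKripke.InitPath π ∧ M.FairPath π) ↔
    (∃ (k : ℕ) (σ : ℕ → L2SState S f), L2SUnroll M k σ ∧ (σ k).loopClosed) := by
  exact ⟨fun ⟨π, hI, hF⟩ => l2s_forward M π hI hF,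
    fun ⟨k, σ, hU, hc⟩ => l2s_backward M k σ hU hc⟩
end

section
/- Let φ be a PLTL formula and π a (k,l)-loop. For every i ≥ l, if the time point i belongs to the d-unrolling of the loop with d ≥ δ(φ), then π^i ⊨ φ if and only if π^j ⊨ φ, where j = i − (d − δ(φ))·p(π). -/
namespace BMC

/-- PLTL formulas in positive normal form: literals `p`, `¬p`, conjunction,
disjunction, next `X`, until `U`, release `R`, previous `Y`, weak previous `Z`,
since `S` and trigger `T`. -/
inductive PLTL (AP : Type) : Type
  | atom  : AP → PLTL AP
  | natom : AP → PLTL AP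
  | conj  : PLTL AP → PLTL AP → PLTL AP
  | disj  : PLTL AP → PLTL AP → PLTL AP
  | next  : PLTL AP → PLTL AP
  | untl  : PLTL AP → PLTL AP → PLTL AP
  | rels  : PLTL AP → PLTL AP → PLTL AP
  | prev  : PLTL AP → PLTL AP
  | wprev : PLTL AP → PLTL AP
  | since : PLTL AP → PLTL AP → PLTL AP
  | trig  : PLTL AP → PLTL AP → PLTL AP

variable {AP S : Type}

/-- Standard PLTL semantics `π^i ⊨ φ` on an infinite sequence of states `π`
with labelling `L`. -/
def PLTL.sat (L : S → Set AP) (π : ℕ → S) : PLTL AP → ℕ → Prop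
  | .atom p, i => p ∈ L (π i)
  | .natom p, i => p ∉ L (π i)
  | .conj f g, i => PLTL.sat L π f i ∧ PLTL.sat L π g i
  | .disj f g, i => PLTL.sat L π f i ∨ PLTL.sat L π g i
  | .next f, i => PLTL.sat L π f (i + 1)
  | .untl f g, i => ∃ j, i ≤ j ∧ PLTL.sat L π g j ∧ ∀ n, i ≤ n → n < j → PLTL.sat L π f n
  | .rels f g, i => ∀ j, i ≤ j → (PLTL.sat L π g j ∨ ∃ n, i ≤ n ∧ n < j ∧ PLTL.sat L π f n)
  | .prev f, i => 0 < i ∧ PLTL.sat L π f (i - 1)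
  | .wprev f, i => i = 0 ∨ PLTL.sat L π f (i - 1)
  | .since f g, i => ∃ j, j ≤ i ∧ PLTL.sat L π g j ∧ ∀ n, j < n → n ≤ i → PLTL.sat L π f n
  | .trig f g, i => ∀ j, j ≤ i → (PLTL.sat L π g j ∨ ∃ n, j < n ∧ n ≤ i ∧ PLTL.sat L π f n)

/-- The no-loop bounded semantics `π^i ⊨_nl φ` with bound `k`: future operators
are restricted to positions `≤ k`. -/
def PLTL.satNL (L : S → Set AP) (π : ℕ → S) (k : ℕ) : PLTL AP → ℕ → Prop
  | .atom p, i => p ∈ L (π i)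
  | .natom p, i => p ∉ L (π i)
  | .conj f g, i => PLTL.satNL L π k f i ∧ PLTL.satNL L π k g i
  | .disj f g, i => PLTL.satNL L π k f i ∨ PLTL.satNL L π k g i
  | .next f, i => i < k ∧ PLTL.satNL L π k f (i + 1)
  | .untl f g, i => ∃ j, i ≤ j ∧ j ≤ k ∧ PLTL.satNL L π k g j ∧
      ∀ n, i ≤ n → n < j → PLTL.satNL L π k f n
  | .rels f g, i => ∃ j, i ≤ j ∧ j ≤ k ∧ PLTL.satNL L π k f j ∧
      ∀ n, i ≤ n → n ≤ j → PLTL.satNL L π k g n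
  | .prev f, i => 0 < i ∧ PLTL.satNL L π k f (i - 1)
  | .wprev f, i => i = 0 ∨ PLTL.satNL L π k f (i - 1)
  | .since f g, i => ∃ j, j ≤ i ∧ PLTL.satNL L π k g j ∧
      ∀ n, j < n → n ≤ i → PLTL.satNL L π k f n
  | .trig f g, i => ∀ j, j ≤ i → (PLTL.satNL L π k g j ∨
      ∃ n, j < n ∧ n ≤ i ∧ PLTL.satNL L π k f n)

/-- The bounded semantics `π ⊨_k φ`. -/
def PLTL.bsat (L : S → Set AP) (π : ℕ → S) (k : ℕ) (φ : PLTL AP) : Prop :=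
  (∃ l, IsKLoop π k l ∧ PLTL.sat L π φ 0) ∨ PLTL.satNL L π k φ 0

/-- The past operator depth `δ`. -/
def PLTL.delta : PLTL AP → ℕ
  | .atom _ => 0
  | .natom _ => 0
  | .conj f g => max f.delta g.delta
  | .disj f g => max f.delta g.delta
  | .next f => f.delta
  | .untl f g => max f.delta g.delta
  | .rels f g => max f.delta g.delta
  | .prev f => f.delta + 1
  | .wprev f => f.delta + 1
  | .since f g => max f.delta g.delta + 1
  | .trig f g => max f.delta g.delta + 1

end BMC
namespace BMC

/-- The period `p(π) = (k - l) + 1` of a (k,l)-loop. -/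
def loopPeriod (k l : ℕ) : ℕ := (k - l) + 1

/-- Time point `i` belongs to the `d`-unrolling of the loop of a (k,l)-loop:
`d` is the smallest natural number such that `i < l + (d+1)·p(π)`. -/
def InUnrolling (k l i d : ℕ) : Prop :=
  i < l + (d + 1) * loopPeriod k l ∧
  ∀ d' : ℕ, i < l + (d' + 1) * loopPeriod k l → d ≤ d'

end BMC

namespace BMC

/-- `P` is periodic with period `p` from `a` on. -/
def Per (p a : ℕ) (P : ℕ → Prop) : Prop := ∀ n, a ≤ n → (P (n + p) ↔ P n)

theorem Per.mono {p a b : ℕ} {P : ℕ → Prop} (h : Per p a P) (hab : a ≤ b) : Per p b P :=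
  fun n hn => h n (hab.trans hn)

theorem Per.not {p a : ℕ} {P : ℕ → Prop} (h : Per p a P) : Per p a (fun n => ¬ P n) :=
  fun n hn => not_congr (h n hn)

theorem Per.of_not {p a : ℕ} {P : ℕ → Prop} (h : Per p a (fun n => ¬ P n)) : Per p a P :=
  fun n hn => not_iff_not.mp (h n hn)

theorem Per.untl {p a : ℕ} {F G : ℕ → Prop} (hF : Per p a F) (hG : Per p a G) :
    Per p a (fun i => ∃ j, i ≤ j ∧ G j ∧ ∀ n, i ≤ n → n < j → F n) := by
  intro n hn
  constructor
  · rintro ⟨j, hj, hg, hf⟩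
    refine ⟨j - p, by omega, ?_, ?_⟩
    · rw [← hG (j - p) (by omega)]
      rwa [Nat.sub_add_cancel (by omega)]
    · intro m h1 h2
      exact (hF m (by omega)).mp (hf (m + p) (by omega) (by omega))
  · rintro ⟨j, hj, hg, hf⟩
    refine ⟨j + p, by omega, (hG j (by omega)).mpr hg, ?_⟩
    intro m h1 h2
    have := (hF (m - p) (by omega)).mpr (hf (m - p) (by omega) (by omega))
    rwa [Nat.sub_add_cancel (by omega)] at this

theorem Per.since {p a : ℕ} {F G : ℕ → Prop} (hF : Per p a F) (hG : Per p a G) :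
    Per p (a + p) (fun i => ∃ j, j ≤ i ∧ G j ∧ ∀ n, j < n → n ≤ i → F n) := by
  intro n hn
  constructor
  · rintro ⟨j, hj, hg, hf⟩
    by_cases hja : a + p ≤ j
    · refine ⟨j - p, by omega, ?_, ?_⟩
      · rw [← hG (j - p) (by omega)]
        rwa [Nat.sub_add_cancel (by omega)]
      · intro m h1 h2
        exact (hF m (by omega)).mp (hf (m + p) (by omega) (by omega))
    · exact ⟨j, by omega, hg, fun m h1 h2 => hf m h1 (by omega)⟩
  · rintro ⟨j, hj, hg, hf⟩
    by_cases hja : a ≤ j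
    · refine ⟨j + p, by omega, (hG j (by omega)).mpr hg, ?_⟩
      intro m h1 h2
      have := (hF (m - p) (by omega)).mpr (hf (m - p) (by omega) (by omega))
      rwa [Nat.sub_add_cancel (by omega)] at this
    · refine ⟨j, by omega, hg, ?_⟩
      intro m h1 h2
      by_cases hm : m ≤ n
      · exact hf m h1 hm
      · have := (hF (m - p) (by omega)).mpr (hf (m - p) (by omega) (by omega))
        rwa [Nat.sub_add_cancel (by omega)] at this

theorem Per.rels {p a : ℕ} {F G : ℕ → Prop} (hF : Per p a F) (hG : Per p a G) :
    Per p a (fun i => ∀ j, i ≤ j → (G j ∨ ∃ n, i ≤ n ∧ n < j ∧ F n)) := by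
  apply Per.of_not
  have := Per.untl hF.not hG.not
  push Not
  exact this

theorem Per.trig {p a : ℕ} {F G : ℕ → Prop} (hF : Per p a F) (hG : Per p a G) :
    Per p (a + p) (fun i => ∀ j, j ≤ i → (G j ∨ ∃ n, j < n ∧ n ≤ i ∧ F n)) := by
  apply Per.of_not
  have := Per.since hF.not hG.not
  push Not
  exact this

theorem per_sat {S AP : Type} (L : S → Set AP) (π : ℕ → S) (p l : ℕ) (hp : 0 < p)
    (h : ∀ i, l ≤ i → π (i + p) = π i) (φ : PLTL AP) :
    Per p (l + φ.delta * p) (fun i => PLTL.sat L π φ i) := by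
  have hl : ∀ a b : ℕ, l + a * p ≤ l + max a b * p := fun a b => by
    gcongr; exact le_max_left _ _
  have hr : ∀ a b : ℕ, l + b * p ≤ l + max a b * p := fun a b => by
    gcongr; exact le_max_right _ _
  have e : ∀ a : ℕ, l + (a + 1) * p = l + a * p + p := fun a => by ring
  induction φ with
  | atom q => intro n hn; simp only [PLTL.sat]; rw [h n (le_trans (Nat.le_add_right _ _) hn)]
  | natom q => intro n hn; simp only [PLTL.sat]; rw [h n (le_trans (Nat.le_add_right _ _) hn)]
  | conj f g hf hg =>
    intro n hn
    exact and_congr (hf.mono (hl _ _) n hn) (hg.mono (hr _ _) n hn)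
  | disj f g hf hg =>
    intro n hn
    exact or_congr (hf.mono (hl _ _) n hn) (hg.mono (hr _ _) n hn)
  | next f hf =>
    intro n hn
    simp only [PLTL.sat]
    simp only [PLTL.delta] at hn
    rw [show n + p + 1 = n + 1 + p by omega]
    exact hf (n + 1) (by omega)
  | untl f g hf hg => exact Per.untl (hf.mono (hl _ _)) (hg.mono (hr _ _))
  | rels f g hf hg => exact Per.rels (hf.mono (hl _ _)) (hg.mono (hr _ _))
  | prev f hf =>
    intro n hn
    simp only [PLTL.sat]
    simp only [PLTL.delta, e] at hn
    rw [show n + p - 1 = n - 1 + p by omega]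
    exact and_congr (by omega) (hf (n - 1) (by omega))
  | wprev f hf =>
    intro n hn
    simp only [PLTL.sat]
    simp only [PLTL.delta, e] at hn
    rw [show n + p - 1 = n - 1 + p by omega]
    exact or_congr (by omega) (hf (n - 1) (by omega))
  | since f g hf hg =>
    simp only [PLTL.delta, e]
    exact Per.since (hf.mono (hl _ _)) (hg.mono (hr _ _))
  | trig f g hf hg =>
    simp only [PLTL.delta, e]
    exact Per.trig (hf.mono (hl _ _)) (hg.mono (hr _ _))

theorem Per.mul {p a : ℕ} {P : ℕ → Prop} (h : Per p a P) (n : ℕ) (hn : a ≤ n) (m : ℕ) :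
    P (n + m * p) ↔ P n := by
  induction m with
  | zero => simp
  | succ m ih =>
    rw [← ih, ← h (n + m * p) (by omega)]
    rw [show n + (m + 1) * p = n + m * p + p by ring]

end BMC

open BMC in
/-- Proposition (stabilisation): for a (k,l)-loop `π` and a PLTL formula `φ`,
for all `i ≥ l`, if `i` belongs to the `d`-unrolling of the loop with
`d ≥ δ(φ)`, then `π^i ⊨ φ` iff `π^j ⊨ φ` where
`j = i - (d - δ(φ))·p(π)`. -/
theorem pltl_loop_stabilisation {S AP : Type} (L : S → Set AP) (π : ℕ → S)
    (k l : ℕ) (hloop : IsKLoop π k l) (φ : PLTL AP) (i d : ℕ)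
    (hi : l ≤ i) (hd : InUnrolling k l i d) (hδ : φ.delta ≤ d) :
    (PLTL.sat L π φ i ↔ PLTL.sat L π φ (i - (d - φ.delta) * loopPeriod k l)) := by
  obtain ⟨hl0, hlk, -, hper⟩ := hloop
  have hP := per_sat L π (loopPeriod k l) l (Nat.succ_pos _) (fun i hi => by
    have := hper i hi
    rwa [show k + 1 - l = loopPeriod k l by unfold loopPeriod; omega] at this) φ
  have hid : l + d * loopPeriod k l ≤ i := by
    rcases d with _ | d
    · simpa using hi
    · by_contra hc
      have := hd.2 d (by omega)
      omega
  obtain ⟨m, rfl⟩ := Nat.exists_eq_add_of_le hδ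
  rw [Nat.add_sub_cancel_left]
  rw [add_mul] at hid
  have := Per.mul hP (i - m * loopPeriod k l) (by omega) m
  rwa [Nat.sub_add_cancel (by omega)] at this
end
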